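/- Let r be a positive integer and X a definable C^r submanifold of ℝⁿ. Then there exist a definable open subset U of ℝⁿ with X ⊆ U and a definable C^r map ρ: U → X with ρ(x) = x for every x ∈ X (a definable C^r retraction of a definable tubular neighborhood onto X). -/

import Mathlib

open FirstOrder Set Topology

namespace Paper

variable (L : FirstOrder.Language) [L.Structure ℝ]

/-- A subset of `ℝⁿ` is definable in the structure (with parameters from `ℝ`). -/
def Def (n : ℕ) (s : Set (Fin n → ℝ)) : Prop :=
  Set.Definable (Set.univ : Set ℝ) L s

/-- A subset of `ℝ` is definable. -/
def Def1 (s : Set ℝ) : Prop := Def L 1 {x | x 0 ∈ s}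

/-- The structure expands the ordered field `(ℝ, <, +, ·, 0, 1)`:
the order and the field operations (and the constants) are definable. -/
def ExpandsOrderedField : Prop :=
  Def L 2 {x | x 0 < x 1} ∧ Def L 3 {x | x 0 + x 1 = x 2} ∧
  Def L 3 {x | x 0 * x 1 = x 2} ∧ Def L 1 {x | x 0 = 0} ∧ Def L 1 {x | x 0 = 1}

/-- Local o-minimality: every definable subset of `ℝ` is, near each point, a finite
union of points and open intervals. -/
def LocallyOMinimal : Prop :=
  ∀ X : Set ℝ, Def1 L X → ∀ a : ℝ,
    ∃ b c : ℝ, b < a ∧ a < c ∧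
      ∃ (P : Finset ℝ) (J : Finset (ℝ × ℝ)),
        X ∩ Set.Ioo b c = ↑P ∪ ⋃ p ∈ J, Set.Ioo p.1 p.2

/-- First component of a point of `ℝ^(m+n) = ℝ^m × ℝ^n`. -/
def fstFun {m n : ℕ} (z : Fin (m + n) → ℝ) : Fin m → ℝ := fun i => z (Fin.castAdd n i)

/-- Second component of a point of `ℝ^(m+n) = ℝ^m × ℝ^n`. -/
def sndFun {m n : ℕ} (z : Fin (m + n) → ℝ) : Fin n → ℝ := fun j => z (Fin.natAdd m j)

/-- The map `f : X → ℝⁿ`, `X ⊆ ℝ^m`, is definable (its graph over `X` is definable). -/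
def DefMapOn (m n : ℕ) (X : Set (Fin m → ℝ)) (f : (Fin m → ℝ) → (Fin n → ℝ)) : Prop :=
  Def L (m + n) {z | fstFun z ∈ X ∧ sndFun z = f (fstFun z)}

/-- The function `f : X → ℝ`, `X ⊆ ℝ^m`, is definable. -/
def DefFunOn (m : ℕ) (X : Set (Fin m → ℝ)) (f : (Fin m → ℝ) → ℝ) : Prop :=
  DefMapOn L m 1 X fun x _ => f x

/-- `f` is of class `C^r` on `X` in the sense that near every point of `X` it agrees on `X`
with a `C^r` map defined on an open neighborhood in the ambient space. -/
def CrMapOn (r m n : ℕ) (X : Set (Fin m → ℝ)) (f : (Fin m → ℝ) → (Fin n → ℝ)) : Prop :=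
  ∀ a ∈ X, ∃ (W : Set (Fin m → ℝ)) (g : (Fin m → ℝ) → (Fin n → ℝ)),
    a ∈ W ∧ IsOpen W ∧ ContDiffOn ℝ r g W ∧ Set.EqOn f g (X ∩ W)

/-- Real-valued version of `CrMapOn`. -/
def CrFunOn (r m : ℕ) (X : Set (Fin m → ℝ)) (f : (Fin m → ℝ) → ℝ) : Prop :=
  ∀ a ∈ X, ∃ (W : Set (Fin m → ℝ)) (g : (Fin m → ℝ) → ℝ),
    a ∈ W ∧ IsOpen W ∧ ContDiffOn ℝ r g W ∧ Set.EqOn f g (X ∩ W)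

/-- A definable `C^r` map `X → ℝⁿ`. -/
def DefCrMapOn (r m n : ℕ) (X : Set (Fin m → ℝ)) (f : (Fin m → ℝ) → (Fin n → ℝ)) : Prop :=
  DefMapOn L m n X f ∧ CrMapOn r m n X f

/-- A definable `C^r` function `X → ℝ`. -/
def DefCrFunOn (r m : ℕ) (X : Set (Fin m → ℝ)) (f : (Fin m → ℝ) → ℝ) : Prop :=
  DefFunOn L m X f ∧ CrFunOn r m X f

/-- A definable `C^r` submanifold of `ℝⁿ` of dimension `d`: around every point there is a
definable `C^r` chart of `ℝⁿ` straightening `M` to the first `d` coordinates. -/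
def IsDefCrSubmanifold (r n d : ℕ) (M : Set (Fin n → ℝ)) : Prop :=
  Def L n M ∧
  ∀ a ∈ M, ∃ (U V : Set (Fin n → ℝ)) (φ ψ : (Fin n → ℝ) → (Fin n → ℝ)),
    a ∈ U ∧ IsOpen U ∧ Def L n U ∧
    (0 : Fin n → ℝ) ∈ V ∧ IsOpen V ∧ Def L n V ∧
    DefMapOn L n n U φ ∧ DefMapOn L n n V ψ ∧
    ContDiffOn ℝ r φ U ∧ ContDiffOn ℝ r ψ V ∧
    Set.BijOn φ U V ∧ Set.InvOn ψ φ U V ∧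
    φ a = 0 ∧
    φ '' (M ∩ U) = {x ∈ V | ∀ i : Fin n, d ≤ (i : ℕ) → x i = 0}

/-- The Euclidean norm on `ℝⁿ`. -/
noncomputable def eunorm {n : ℕ} (x : Fin n → ℝ) : ℝ := Real.sqrt (∑ i, x i ^ 2)

/-- Projection of `ℝⁿ` onto the `d` coordinates selected by `σ`. -/
def coordProj {n : ℕ} (d : ℕ) (σ : Fin d → Fin n) (x : Fin n → ℝ) : Fin d → ℝ :=
  fun i => x (σ i)

/-- `X ⊆ ℝⁿ` has dimension `d`: `d` is the largest integer such that some coordinate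
projection of `X` onto `ℝ^d` has nonempty interior. -/
def HasDim {n : ℕ} (X : Set (Fin n → ℝ)) (d : ℕ) : Prop :=
  (∃ σ : Fin d → Fin n, Function.Injective σ ∧ (interior (coordProj d σ '' X)).Nonempty) ∧
  ∀ (e : ℕ) (σ : Fin e → Fin n), Function.Injective σ →
    (interior (coordProj e σ '' X)).Nonempty → e ≤ d

/-- A (bounded) open box in `ℝⁿ`. -/
def IsOpenBox {n : ℕ} (B : Set (Fin n → ℝ)) : Prop :=
  ∃ a b : Fin n → ℝ, (∀ i, a i < b i) ∧ B = Set.pi Set.univ fun i => Set.Ioo (a i) (b i)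

section Definability

/-- Types coordinatised by finitely many real numbers. -/
class Coord (α : Type) where
  /-- the index type of the coordinates -/
  idx : Type
  /-- there are finitely many coordinates -/
  finite : Finite idx
  /-- the coordinates of a point -/
  coords : α ≃ (idx → ℝ)

attribute [instance] Coord.finite

instance : Coord ℝ := ⟨Unit, inferInstance, (Equiv.funUnique Unit ℝ).symm⟩

instance (n : ℕ) : Coord (Fin n → ℝ) := ⟨Fin n, inferInstance, Equiv.refl _⟩

instance (α β : Type) [Coord α] [Coord β] : Coord (α × β) :=
  ⟨Coord.idx α ⊕ Coord.idx β, inferInstance,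
    (Equiv.prodCongr Coord.coords Coord.coords).trans (Equiv.sumArrowEquivProdArrow _ _ _).symm⟩

variable {α β γ : Type} [Coord α] [Coord β] [Coord γ]

/-- A predicate on a coordinatised type is definable. -/
def DefP (p : α → Prop) : Prop :=
  (Set.univ : Set ℝ).Definable L {v : Coord.idx α → ℝ | p (Coord.coords.symm v)}

/-- A function between coordinatised types is definable, i.e. its graph is. -/
@[fun_prop]
def DefFn (f : α → β) : Prop := DefP L fun z : α × β => f z.1 = z.2

variable {L}

theorem Def.defP {n : ℕ} {s : Set (Fin n → ℝ)} (h : Def L n s) : DefP L (· ∈ s) := h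

theorem DefP.def {n : ℕ} {s : Set (Fin n → ℝ)} (h : DefP L (· ∈ s)) : Def L n s := h

theorem DefP.of_definable {p : α → Prop} {S : Set (Coord.idx α → ℝ)}
    (h : (Set.univ : Set ℝ).Definable L S) (hS : ∀ v, v ∈ S ↔ p (Coord.coords.symm v)) :
    DefP L p := by
  rwa [show S = {v : Coord.idx α → ℝ | p (Coord.coords.symm v)} from Set.ext hS] at h

theorem DefP.congr {p q : α → Prop} (h : DefP L p) (hpq : ∀ x, q x ↔ p x) : DefP L q := by
  rwa [show q = p from funext fun x => propext (hpq x)]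

theorem DefP.and {p q : α → Prop} (hp : DefP L p) (hq : DefP L q) :
    DefP L fun x => p x ∧ q x := Definable.inter hp hq

theorem DefP.or {p q : α → Prop} (hp : DefP L p) (hq : DefP L q) :
    DefP L fun x => p x ∨ q x := Definable.union hp hq

theorem DefP.not {p : α → Prop} (hp : DefP L p) : DefP L fun x => ¬ p x := Definable.compl hp

theorem DefP.imp {p q : α → Prop} (hp : DefP L p) (hq : DefP L q) :
    DefP L fun x => p x → q x :=
  (hp.not.or hq).congr fun _ => imp_iff_not_or

theorem DefP.iff {p q : α → Prop} (hp : DefP L p) (hq : DefP L q) :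
    DefP L fun x => p x ↔ q x :=
  ((hp.imp hq).and (hq.imp hp)).congr fun _ => iff_iff_implies_and_implies

theorem DefP.const (p : Prop) : DefP L fun _ : α => p := by
  by_cases h : p
  · simp [DefP, h]
  · simp [DefP, h]

theorem DefP.ex {p : α → β → Prop} (hp : DefP L fun z : α × β => p z.1 z.2) :
    DefP L fun x => ∃ y, p x y := by
  have := Definable.exists_of_finite (α := Coord.idx α) (β := Coord.idx β) hp
  refine DefP.of_definable this fun v => ?_
  constructor
  · rintro ⟨u, hu⟩
    exact ⟨Coord.coords.symm u, hu⟩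
  · rintro ⟨y, hy⟩
    refine ⟨Coord.coords y, ?_⟩
    change p (Coord.coords.symm v) (Coord.coords.symm (Coord.coords y))
    rwa [Equiv.symm_apply_apply]

theorem DefP.all {p : α → β → Prop} (hp : DefP L fun z : α × β => p z.1 z.2) :
    DefP L fun x => ∀ y, p x y :=
  (DefP.not (DefP.ex (p := fun x y => ¬ p x y) hp.not)).congr fun x => by simp

theorem DefP.all_finite {ι : Type} [Finite ι] {p : ι → α → Prop} (hp : ∀ i, DefP L (p i)) :
    DefP L fun x => ∀ i, p i x := by
  have := definable_iInter_of_finite (f := fun i => {v | p i (Coord.coords.symm v)}) hp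
  refine DefP.of_definable this fun v => ?_
  simp

theorem DefP.ex_finite {ι : Type} [Finite ι] {p : ι → α → Prop} (hp : ∀ i, DefP L (p i)) :
    DefP L fun x => ∃ i, p i x :=
  (DefP.not (DefP.all_finite fun i => (hp i).not)).congr fun x => by simp

/-- A map given by selecting coordinates pulls back definable predicates. -/
theorem DefP.reindex {p : β → Prop} (hp : DefP L p) {f : α → β} (g : Coord.idx β → Coord.idx α)
    (h : ∀ x, Coord.coords (f x) = Coord.coords x ∘ g) : DefP L fun x => p (f x) := by
  refine DefP.of_definable (Definable.preimage_comp g hp) fun v => ?_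
  change p _ ↔ p _
  rw [show f (Coord.coords.symm v) = Coord.coords.symm (v ∘ g) by
    rw [Equiv.eq_symm_apply, h, Equiv.apply_symm_apply] ]

theorem DefP.apply_eq_apply (i j : Coord.idx α) :
    DefP L fun x : α => Coord.coords x i = Coord.coords x j := by
  have := Definable.preimage_comp ![i, j] (Definable.diagonal (L := L) (M := ℝ) univ)
  refine DefP.of_definable this fun v => ?_
  change v _ = v _ ↔ Coord.coords _ _ = Coord.coords _ _
  simp

theorem DefP.eq_self : DefP L fun z : α × α => z.1 = z.2 :=
  (DefP.all_finite fun i : Coord.idx α => DefP.apply_eq_apply (L := L) (α := α × α)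
    (Sum.inl i) (Sum.inr i)).congr fun z => by
      rw [← (Coord.coords (α := α)).injective.eq_iff, funext_iff]; rfl

theorem DefFn.reindex {f : α → β} (g : Coord.idx β → Coord.idx α)
    (h : ∀ x, Coord.coords (f x) = Coord.coords x ∘ g) : DefFn L f := by
  refine DefP.reindex (f := fun z : α × β => (f z.1, z.2)) DefP.eq_self (Sum.map g id) ?_
  intro z
  have : Coord.coords (f z.1, z.2) = Sum.elim (Coord.coords (f z.1)) (Coord.coords z.2) := rfl
  rw [this, h]
  ext i
  cases i <;> rfl

@[fun_prop]
theorem DefFn.id' : DefFn L fun x : α => x := DefFn.reindex id fun _ => rfl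

@[fun_prop]
theorem defFn_fst : DefFn L (Prod.fst : α × β → α) := DefFn.reindex Sum.inl fun _ => rfl

@[fun_prop]
theorem defFn_snd : DefFn L (Prod.snd : α × β → β) := DefFn.reindex Sum.inr fun _ => rfl

theorem DefP.comp {p : β → Prop} (hp : DefP L p) {f : α → β} (hf : DefFn L f) :
    DefP L fun x => p (f x) :=
  (DefP.ex (p := fun x y => f x = y ∧ p y)
    (DefP.and hf (hp.reindex (f := fun z : α × β => z.2) Sum.inr fun _ => rfl))).congr
      fun x => by simp

theorem DefFn.graph {f : α → β} (hf : DefFn L f) : DefP L fun z : α × β => f z.1 = z.2 := hf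

@[fun_prop]
theorem DefFn.prodMk {f : α → β} {g : α → γ} (hf : DefFn L f) (hg : DefFn L g) :
    DefFn L fun x => (f x, g x) := by
  have h1 := hf.graph.reindex (α := α × (β × γ)) (f := fun z => (z.1, z.2.1))
    (Sum.elim Sum.inl (Sum.inr ∘ Sum.inl)) fun z => by ext (i | i) <;> rfl
  have h2 := hg.graph.reindex (α := α × (β × γ)) (f := fun z => (z.1, z.2.2))
    (Sum.elim Sum.inl (Sum.inr ∘ Sum.inr)) fun z => by ext (i | i) <;> rfl
  exact (h1.and h2).congr fun z => Prod.ext_iff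

@[fun_prop]
theorem DefFn.comp {g : β → γ} {f : α → β} (hg : DefFn L g) (hf : DefFn L f) :
    DefFn L fun x => g (f x) := by
  have h1 := hf.graph.reindex (α := (α × γ) × β) (f := fun z => (z.1.1, z.2))
    (Sum.elim (Sum.inl ∘ Sum.inl) Sum.inr) fun z => by ext (i | i) <;> rfl
  have h2 := hg.graph.reindex (α := (α × γ) × β) (f := fun z => (z.2, z.1.2))
    (Sum.elim Sum.inr (Sum.inl ∘ Sum.inr)) fun z => by ext (i | i) <;> rfl
  exact (DefP.ex (p := fun (z : α × γ) y => f z.1 = y ∧ g y = z.2) (h1.and h2)).congr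
    fun z => by simp

theorem DefP.eq {f g : α → β} (hf : DefFn L f) (hg : DefFn L g) : DefP L fun x => f x = g x :=
  DefP.eq_self.comp (hf.prodMk hg)

theorem DefFn.of_graph {f : α → β} {p : α → β → Prop} (h : ∀ x y, f x = y ↔ p x y)
    (hp : DefP L fun z : α × β => p z.1 z.2) : DefFn L f :=
  hp.congr fun _ => h _ _

@[fun_prop]
theorem DefFn.const (b : β) : DefFn L fun _ : α => b := by
  refine (DefP.all_finite fun i : Coord.idx β => (?_ : DefP L fun z : α × β =>
    Coord.coords z.2 i = Coord.coords b i)).congr fun z => ?_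
  · refine DefP.of_definable (Definable.preimage_comp
      (fun _ : Fin 1 => (Sum.inr i : Coord.idx (α × β)))
      (Definable.singleton_of_mem L (mem_univ (Coord.coords b i)))) fun v => ?_
    change _ = _ ↔ _ = _
    change v (Sum.inr i) = _ ↔ Coord.coords (Coord.coords.symm _) i = _
    rw [Equiv.apply_symm_apply]
    rfl
  · rw [← (Coord.coords (α := β)).injective.eq_iff, funext_iff]
    exact forall_congr' fun i => eq_comm

@[fun_prop]
theorem defFn_apply {n : ℕ} (i : Fin n) : DefFn L fun x : Fin n → ℝ => x i :=
  DefFn.reindex (fun _ => i) fun _ => rfl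

@[fun_prop]
theorem DefFn.pi {n : ℕ} {f : α → Fin n → ℝ} (h : ∀ i, DefFn L fun x => f x i) : DefFn L f :=
  (DefP.all_finite fun i : Fin n => DefP.eq (L := L) (f := fun z : α × (Fin n → ℝ) => f z.1 i)
    ((h i).comp defFn_fst) ((defFn_apply i).comp defFn_snd)).congr fun _ => funext_iff

/-- A partially specified function is definable as soon as its graph and domain are. -/
theorem DefFn.choose {p : α → β → Prop} (hp : DefP L fun z : α × β => p z.1 z.2) {f : α → β}
    {b : β} (h1 : ∀ x, (∃ y, p x y) → p x (f x)) (h2 : ∀ x, (¬ ∃ y, p x y) → f x = b)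
    (huniq : ∀ x y y', p x y → p x y' → y = y') : DefFn L f := by
  refine DefFn.of_graph (p := fun x y => p x y ∨ ((¬ ∃ y, p x y) ∧ b = y)) (fun x y => ?_) ?_
  · by_cases h : ∃ y, p x y
    · simp only [h, not_true_eq_false, false_and, or_false]
      exact ⟨fun e => e ▸ h1 x h, fun e => huniq _ _ _ (h1 x h) e⟩
    · have : ¬ p x y := fun e => h ⟨y, e⟩
      simp [h2 x h, h, this]
  · refine hp.or ((DefP.not ?_).and (DefP.eq (DefFn.const b) defFn_snd))
    exact (DefP.ex hp).comp defFn_fst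

theorem DefFn.ite {p : α → Prop} [DecidablePred p] {f g : α → β} (hp : DefP L p) (hf : DefFn L f)
    (hg : DefFn L g) : DefFn L fun x => if p x then f x else g x := by
  refine DefFn.of_graph (p := fun x y => (p x ∧ f x = y) ∨ (¬ p x ∧ g x = y)) (fun x y => ?_) ?_
  · split_ifs with h <;> simp [h]
  · exact ((hp.comp defFn_fst).and hf).or ((hp.not.comp defFn_fst).and hg)

end Definability

section Arithmetic

variable {L} {α β γ : Type} [Coord α] [Coord β] [Coord γ]

protected theorem DefP.mem {n : ℕ} {s : Set (Fin n → ℝ)} (hs : Def L n s) {f : α → Fin n → ℝ}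
    (hf : DefFn L f) : DefP L fun x => f x ∈ s := DefP.comp hs.defP hf

variable {n k : ℕ}

protected theorem Def.compl {s : Set (Fin n → ℝ)} (hs : Def L n s) : Def L n sᶜ := hs.defP.not.def

protected theorem Def.inter {s t : Set (Fin n → ℝ)} (hs : Def L n s) (ht : Def L n t) :
    Def L n (s ∩ t) :=
  (hs.defP.and ht.defP).def

protected theorem Def.union {s t : Set (Fin n → ℝ)} (hs : Def L n s) (ht : Def L n t) :
    Def L n (s ∪ t) :=
  (hs.defP.or ht.defP).def

protected theorem Def.diff {s t : Set (Fin n → ℝ)} (hs : Def L n s) (ht : Def L n t) :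
    Def L n (s \ t) :=
  (hs.defP.and ht.defP.not).def

protected theorem Def.preimage {s : Set (Fin n → ℝ)} (hs : Def L n s)
    {f : (Fin k → ℝ) → (Fin n → ℝ)} (hf : DefFn L f) : Def L k (f ⁻¹' s) :=
  (DefP.mem hs hf).def

protected theorem Def.image {s : Set (Fin n → ℝ)} (hs : Def L n s) {f : (Fin n → ℝ) → (Fin k → ℝ)}
    (hf : DefFn L f) : Def L k (f '' s) := by
  refine DefP.def (DefP.ex (p := fun x y => y ∈ s ∧ f y = x) ((DefP.mem hs ?_).and
    (DefP.eq ?_ ?_))) <;> fun_prop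

variable [hF : Fact (ExpandsOrderedField L)]

theorem DefP.lt {f g : α → ℝ} (hf : DefFn L f) (hg : DefFn L g) : DefP L fun x => f x < g x :=
  hF.out.1.defP.comp (f := fun x => ![f x, g x]) (DefFn.pi fun i => by fin_cases i <;> assumption)

theorem DefP.le {f g : α → ℝ} (hf : DefFn L f) (hg : DefFn L g) : DefP L fun x => f x ≤ g x :=
  (DefP.lt hg hf).not.congr fun _ => not_lt.symm

@[fun_prop]
theorem DefFn.add {f g : α → ℝ} (hf : DefFn L f) (hg : DefFn L g) : DefFn L fun x => f x + g x :=
  hF.out.2.1.defP.comp (f := fun z : α × ℝ => ![f z.1, g z.1, z.2])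
    (DefFn.pi fun i => by fin_cases i <;> dsimp <;> fun_prop)

@[fun_prop]
theorem DefFn.mul {f g : α → ℝ} (hf : DefFn L f) (hg : DefFn L g) : DefFn L fun x => f x * g x :=
  hF.out.2.2.1.defP.comp (f := fun z : α × ℝ => ![f z.1, g z.1, z.2])
    (DefFn.pi fun i => by fin_cases i <;> dsimp <;> fun_prop)

@[fun_prop]
theorem DefFn.neg {f : α → ℝ} (hf : DefFn L f) : DefFn L fun x => - f x := by
  simpa using (DefFn.const (L := L) (α := α) (-1 : ℝ)).mul hf

@[fun_prop]
theorem DefFn.sub {f g : α → ℝ} (hf : DefFn L f) (hg : DefFn L g) :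
    DefFn L fun x => f x - g x := by
  simpa [sub_eq_add_neg] using hf.add hg.neg

@[fun_prop]
theorem DefFn.inv {f : α → ℝ} (hf : DefFn L f) : DefFn L fun x => (f x)⁻¹ := by
  refine DefFn.of_graph (p := fun x y => (f x = 0 ∧ y = 0) ∨ f x * y = 1) (fun x y => ?_) ?_
  · by_cases h : f x = 0
    · simp [h, eq_comm]
    · simp only [h, false_and, false_or]
      exact ⟨fun e => by rw [← e, mul_inv_cancel₀ h], fun e => (eq_inv_of_mul_eq_one_right e).symm⟩
  · exact ((DefP.eq (by fun_prop) (by fun_prop)).and (DefP.eq (by fun_prop) (by fun_prop))).or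
      (DefP.eq (by fun_prop) (by fun_prop))

@[fun_prop]
theorem DefFn.div {f g : α → ℝ} (hf : DefFn L f) (hg : DefFn L g) :
    DefFn L fun x => f x / g x := by
  simpa [div_eq_mul_inv] using hf.mul hg.inv

@[fun_prop]
theorem DefFn.pow {f : α → ℝ} (hf : DefFn L f) (n : ℕ) : DefFn L fun x => f x ^ n := by
  induction n with
  | zero => simpa using DefFn.const 1
  | succ n ih => simpa [pow_succ] using ih.mul hf

@[fun_prop]
protected theorem DefFn.max {f g : α → ℝ} (hf : DefFn L f) (hg : DefFn L g) :
    DefFn L fun x => max (f x) (g x) := by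
  simp only [max_def]
  exact DefFn.ite (DefP.le hf hg) hg hf

@[fun_prop]
protected theorem DefFn.min {f g : α → ℝ} (hf : DefFn L f) (hg : DefFn L g) :
    DefFn L fun x => min (f x) (g x) := by
  simp only [min_def]
  exact DefFn.ite (DefP.le hf hg) hf hg

@[fun_prop]
protected theorem DefFn.abs {f : α → ℝ} (hf : DefFn L f) : DefFn L fun x => |f x| := by
  simp only [abs_eq_max_neg]
  fun_prop

@[fun_prop]
protected theorem DefFn.sum {n : ℕ} {f : α → Fin n → ℝ} (hf : ∀ i, DefFn L fun x => f x i) :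
    DefFn L fun x => ∑ i, f x i := by
  induction n with
  | zero => simpa using DefFn.const 0
  | succ n ih =>
    simp only [Fin.sum_univ_succ]
    exact (hf 0).add (ih fun i => hf i.succ)

@[fun_prop]
theorem DefFn.addV {n : ℕ} {f g : α → Fin n → ℝ} (hf : DefFn L f) (hg : DefFn L g) :
    DefFn L fun x => f x + g x :=
  DefFn.pi fun i => by simp only [Pi.add_apply]; fun_prop

@[fun_prop]
theorem DefFn.smulV {n : ℕ} {f : α → ℝ} {g : α → Fin n → ℝ} (hf : DefFn L f) (hg : DefFn L g) :
    DefFn L fun x => f x • g x :=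
  DefFn.pi fun i => by simp only [Pi.smul_apply, smul_eq_mul]; fun_prop

@[fun_prop]
theorem DefFn.subV {n : ℕ} {f g : α → Fin n → ℝ} (hf : DefFn L f) (hg : DefFn L g) :
    DefFn L fun x => f x - g x :=
  DefFn.pi fun i => by simp only [Pi.sub_apply]; fun_prop

@[fun_prop]
protected theorem DefFn.norm {n : ℕ} {f : α → Fin n → ℝ} (hf : DefFn L f) :
    DefFn L fun x => ‖f x‖ := by
  refine DefFn.of_graph (p := fun x y => 0 ≤ y ∧ ∀ t : ℝ, 0 ≤ t → (y ≤ t ↔ ∀ i, |f x i| ≤ t))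
    (fun x y => ?_) ?_
  · constructor
    · rintro rfl
      exact ⟨norm_nonneg _, fun t ht => pi_norm_le_iff_of_nonneg ht⟩
    · rintro ⟨hy, h⟩
      have h' : ∀ t : ℝ, 0 ≤ t → (y ≤ t ↔ ‖f x‖ ≤ t) := fun t ht =>
        (h t ht).trans (pi_norm_le_iff_of_nonneg (x := f x) ht).symm
      exact le_antisymm ((h' y hy).1 le_rfl) ((h' _ (norm_nonneg _)).2 le_rfl)
  · refine (DefP.le (by fun_prop) (by fun_prop)).and (DefP.all (DefP.imp
      (DefP.le (by fun_prop) (by fun_prop)) (DefP.iff (DefP.le (by fun_prop) (by fun_prop))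
        (DefP.all_finite fun i => DefP.le (by fun_prop) (by fun_prop)))))

@[fun_prop]
protected theorem DefFn.dist {n : ℕ} {f g : α → Fin n → ℝ} (hf : DefFn L f) (hg : DefFn L g) :
    DefFn L fun x => Dist.dist (f x) (g x) := by
  simp only [dist_eq_norm]
  fun_prop

@[fun_prop]
protected theorem DefFn.distR {f g : α → ℝ} (hf : DefFn L f) (hg : DefFn L g) :
    DefFn L fun x => Dist.dist (f x) (g x) := by
  simp only [Real.dist_eq]
  fun_prop

theorem DefP.bddAbove {p : α → ℝ → Prop} (hp : DefP L fun z : α × ℝ => p z.1 z.2) :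
    DefP L fun x => BddAbove {t | p x t} := by
  change DefP L fun x => ∃ b : ℝ, ∀ ⦃t⦄, p x t → t ≤ b
  refine DefP.ex (DefP.all (DefP.imp (hp.comp (f := fun z : (α × ℝ) × ℝ => (z.1.1, z.2)) ?_)
    (DefP.le ?_ ?_))) <;> fun_prop

protected theorem DefFn.sSup {p : α → ℝ → Prop} (hp : DefP L fun z : α × ℝ => p z.1 z.2) :
    DefFn L fun x => sSup {t | p x t} := by
  classical
  refine DefFn.of_graph (p := fun x y => (((∃ t, p x t) ∧ BddAbove {t | p x t}) ∧
    ∀ b, y ≤ b ↔ ∀ t, p x t → t ≤ b) ∨ (¬((∃ t, p x t) ∧ BddAbove {t | p x t}) ∧ y = 0))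
    (fun x y => ?_) ?_
  · by_cases h : (∃ t, p x t) ∧ BddAbove {t | p x t}
    · simp only [h, not_true_eq_false, false_and, or_false, true_and]
      have h' : ∀ b, SupSet.sSup {t | p x t} ≤ b ↔ ∀ t, p x t → t ≤ b := fun b =>
        csSup_le_iff h.2 h.1
      constructor
      · rintro rfl
        exact h'
      · intro e
        exact le_antisymm ((h' y).2 ((e y).1 le_rfl)) ((e _).2 ((h' _).1 le_rfl))
    · have h0 : SupSet.sSup {t | p x t} = 0 := by
        rcases not_and_or.1 h with h | h
        · rw [show {t | p x t} = ∅ from Set.eq_empty_of_forall_notMem fun t ht => h ⟨t, ht⟩,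
            Real.sSup_empty]
        · exact Real.sSup_of_not_bddAbove h
      simp [h, h0, eq_comm]
  · have h1 : DefP L fun x => ((∃ t, p x t) ∧ BddAbove {t | p x t}) :=
      (DefP.ex hp).and (DefP.bddAbove hp)
    have h2 : DefP L fun z : α × ℝ => ((∃ t, p z.1 t) ∧ BddAbove {t | p z.1 t}) :=
      h1.comp defFn_fst
    refine (h2.and (DefP.all (DefP.iff (DefP.le ?_ ?_) (DefP.all (DefP.imp
      (hp.comp (f := fun z : ((α × ℝ) × ℝ) × ℝ => (z.1.1.1, z.2)) ?_) (DefP.le ?_ ?_)))))).or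
      (h2.not.and (DefP.eq ?_ ?_)) <;> fun_prop

theorem DefP.eventually_nhds {p : α → (Fin n → ℝ) → Prop} {a : α → Fin n → ℝ}
    (hp : DefP L fun z : α × (Fin n → ℝ) => p z.1 z.2) (ha : DefFn L a) :
    DefP L fun x => ∀ᶠ y in 𝓝 (a x), p x y := by
  simp only [Metric.eventually_nhds_iff]
  refine DefP.ex (DefP.and (DefP.lt ?_ ?_) (DefP.all (DefP.imp (DefP.lt ?_ ?_)
    (hp.comp (f := fun z : (α × ℝ) × (Fin n → ℝ) => (z.1.1, z.2)) ?_)))) <;> fun_prop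

protected theorem Def.interior {s : Set (Fin n → ℝ)} (hs : Def L n s) : Def L n (interior s) := by
  refine DefP.def ?_
  simp only [mem_interior_iff_mem_nhds]
  exact DefP.eventually_nhds (p := fun _ y => y ∈ s) (DefP.mem hs (by fun_prop)) (by fun_prop)

protected theorem Def.closure {s : Set (Fin n → ℝ)} (hs : Def L n s) : Def L n (closure s) := by
  rw [closure_eq_compl_interior_compl]
  exact hs.compl.interior.compl

protected theorem DefP.continuousAt {F : α → (Fin n → ℝ) → ℝ} {a : α → Fin n → ℝ}
    (hF : DefFn L fun z : α × (Fin n → ℝ) => F z.1 z.2) (ha : DefFn L a) :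
    DefP L fun x => ContinuousAt (F x) (a x) := by
  simp only [ContinuousAt, Metric.tendsto_nhds]
  have h1 : DefFn L fun z : ((α × ℝ) × (Fin n → ℝ)) => F z.1.1 z.2 :=
    hF.comp (f := fun z : ((α × ℝ) × (Fin n → ℝ)) => (z.1.1, z.2)) (by fun_prop)
  have h2 : DefFn L fun z : ((α × ℝ) × (Fin n → ℝ)) => F z.1.1 (a z.1.1) :=
    hF.comp (f := fun z : ((α × ℝ) × (Fin n → ℝ)) => (z.1.1, a z.1.1)) (by fun_prop)
  refine DefP.all (DefP.imp (DefP.lt ?_ ?_) (DefP.eventually_nhds (DefP.lt ?_ ?_) ?_)) <;> fun_prop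

end Arithmetic

section Omin

variable {L} {α : Type} [Coord α] [hF : Fact (ExpandsOrderedField L)]
  [hO : Fact (LocallyOMinimal L)]

theorem DefP.exists_local {p : ℝ → Prop} (hp : DefP L p) (a : ℝ) :
    ∃ b c : ℝ, b < a ∧ a < c ∧ ∃ (P : Finset ℝ) (J : Finset (ℝ × ℝ)),
      {t | p t} ∩ Set.Ioo b c = ↑P ∪ ⋃ q ∈ J, Set.Ioo q.1 q.2 :=
  hO.out {t | p t} (hp.comp (f := fun x : Fin 1 → ℝ => x 0) (by fun_prop)).def a

theorem DefP.interior_nonempty_of_accPt {p : ℝ → Prop} (hp : DefP L p) {a : ℝ}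
    (ha : AccPt a (Filter.principal {t | p t})) : (interior {t | p t}).Nonempty := by
  obtain ⟨b, c, hb, hc, P, J, h⟩ := hp.exists_local a
  have hinf : ({t | p t} ∩ Ioo b c).Infinite := by
    have h1 := (accPt_iff_frequently_nhdsNE.1 ha).and_eventually
      (nhdsWithin_le_nhds (Ioo_mem_nhds hb hc))
    exact Set.Infinite.of_accPt (accPt_iff_frequently_nhdsNE.2 h1)
  by_contra hne
  rw [not_nonempty_iff_eq_empty] at hne
  refine hinf (P.finite_toSet.subset ?_)
  rw [h]
  refine union_subset le_rfl (iUnion₂_subset fun q hq t ht => ?_)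
  exfalso
  have hs : Ioo q.1 q.2 ⊆ {t | p t} := fun s hs =>
    (h.symm.subset (Or.inr (mem_biUnion hq hs))).1
  have : t ∈ interior {t | p t} := interior_maximal hs isOpen_Ioo ht
  simp [hne] at this

theorem DefP.interior_nonempty_of_infinite {p : ℝ → Prop} (hp : DefP L p)
    (hinf : {t | p t}.Infinite) : (interior {t | p t}).Nonempty := by
  by_cases h : ({t | p t} ∩ Icc (-1) 1).Infinite
  · obtain ⟨x, -, hx⟩ := h.exists_accPt_of_subset_isCompact isCompact_Icc inter_subset_right
    exact hp.interior_nonempty_of_accPt (hx.mono (Filter.principal_mono.2 inter_subset_left))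
  have h' : ({t | p t} \ Icc (-1) 1).Infinite := by
    intro hf
    refine hinf ((hf.union (not_infinite.1 h)).subset fun t ht => ?_)
    by_cases h1 : t ∈ Icc (-1 : ℝ) 1
    exacts [Or.inr ⟨ht, h1⟩, Or.inl ⟨ht, h1⟩]
  let q : ℝ → Prop := fun t => t ≠ 0 ∧ p t⁻¹
  have hq : DefP L q := (DefP.eq (by fun_prop) (by fun_prop)).not.and (hp.comp (by fun_prop))
  have hsub : Inv.inv '' ({t | p t} \ Icc (-1) 1) ⊆ {t | q t} ∩ Icc (-1) 1 := by
    rintro _ ⟨t, ⟨ht, ht1⟩, rfl⟩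
    rw [mem_Icc, ← abs_le, not_le] at ht1
    have ht0 : t ≠ 0 := by
      rintro rfl
      norm_num at ht1
    refine ⟨⟨inv_ne_zero ht0, by simpa using ht⟩, ?_⟩
    rw [mem_Icc, ← abs_le, abs_inv]
    exact inv_le_one_of_one_le₀ ht1.le
  have hqi : ({t | q t} ∩ Icc (-1) 1).Infinite :=
    (h'.image inv_injective.injOn).mono hsub
  obtain ⟨x, -, hx⟩ := hqi.exists_accPt_of_subset_isCompact isCompact_Icc inter_subset_right
  obtain ⟨y, hy⟩ := hq.interior_nonempty_of_accPt
    (hx.mono (Filter.principal_mono.2 inter_subset_left))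
  have hy0 : y ≠ 0 := (interior_subset hy).1
  refine ⟨y⁻¹, mem_interior_iff_mem_nhds.2 ?_⟩
  have hc : ContinuousAt (fun t : ℝ => t⁻¹) y⁻¹ := continuousAt_inv₀ (inv_ne_zero hy0)
  have : {t | q t} ∈ 𝓝 ((y⁻¹)⁻¹) := by rw [inv_inv]; exact mem_interior_iff_mem_nhds.1 hy
  filter_upwards [hc this] with t ht
  simpa using ht.2

theorem exists_Ioo_of_interior_nonempty {s : Set ℝ} (h : (interior s).Nonempty) :
    ∃ a b : ℝ, a < b ∧ Ioo a b ⊆ s := by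
  obtain ⟨x, hx⟩ := h
  obtain ⟨a, b, hab, h⟩ := mem_nhds_iff_exists_Ioo_subset.1 (mem_interior_iff_mem_nhds.1 hx)
  exact ⟨a, b, hab.1.trans hab.2, h⟩

theorem DefP.eventually_or {p : ℝ → Prop} (hp : DefP L p) (a : ℝ) :
    (∀ᶠ t in 𝓝[>] a, p t) ∨ ∀ᶠ t in 𝓝[>] a, ¬ p t := by
  obtain ⟨b, c, hb, hc, P, J, h⟩ := hp.exists_local a
  by_cases hJ : ∃ q ∈ J, q.1 ≤ a ∧ a < q.2
  · obtain ⟨q, hq, h1, h2⟩ := hJ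
    left
    filter_upwards [Ioo_mem_nhdsGT h2] with t ht
    exact (h.symm.subset (Or.inr (mem_biUnion hq ⟨h1.trans_lt ht.1, ht.2⟩))).1
  · right
    push Not at hJ
    have h1 : ∀ᶠ t in 𝓝[>] a, t ∉ P := by
      have : ∀ᶠ t in 𝓝[>] a, ∀ s ∈ P, t ≠ s := by
        rw [Filter.eventually_all_finset]
        intro s _
        rcases lt_or_ge a s with has | has
        · filter_upwards [Ioo_mem_nhdsGT has] with t ht using ht.2.ne
        · filter_upwards [self_mem_nhdsWithin] with t ht using (has.trans_lt ht).ne'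
      filter_upwards [this] with t ht hP using ht t hP rfl
    have h2 : ∀ᶠ t in 𝓝[>] a, ∀ q ∈ J, t ∉ Ioo q.1 q.2 := by
      rw [Filter.eventually_all_finset]
      intro q hq
      rcases lt_or_ge a q.1 with has | has
      · filter_upwards [Ioo_mem_nhdsGT has] with t ht h' using ht.2.not_gt h'.1
      · filter_upwards [self_mem_nhdsWithin] with t ht h'
        exact ((hJ q hq has).trans_lt ht).not_gt h'.2
    filter_upwards [h1, h2, Ioo_mem_nhdsGT hc] with t ht1 ht2 ht3 hpt
    rcases h.subset ⟨hpt, hb.trans ht3.1, ht3.2⟩ with h | h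
    · exact ht1 h
    · obtain ⟨q, hq, h⟩ := mem_iUnion₂.1 h
      exact ht2 q hq h

/-- The points of `ℝⁿ` over which the fibre of `A ⊆ ℝⁿ⁺¹` contains an interval. -/
def fatFibers {n : ℕ} (A : Set (Fin (n + 1) → ℝ)) : Set (Fin n → ℝ) :=
  {x | ∃ a b : ℝ, a < b ∧ ∀ t, a < t → t < b → (Fin.snoc x t : Fin (n + 1) → ℝ) ∈ A}

@[fun_prop]
theorem DefFn.snoc {n : ℕ} {f : α → Fin n → ℝ} {g : α → ℝ} (hf : DefFn L f) (hg : DefFn L g) :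
    DefFn L fun x => (Fin.snoc (f x) (g x) : Fin (n + 1) → ℝ) := by
  refine DefFn.pi fun i => ?_
  induction i using Fin.lastCases with
  | last => simpa using hg
  | cast i => simp only [Fin.snoc_castSucc]; fun_prop

protected theorem Def.fatFibers {n : ℕ} {A : Set (Fin (n + 1) → ℝ)} (hA : Def L (n + 1) A) :
    Def L n (fatFibers A) := by
  refine DefP.def (DefP.ex (DefP.ex (DefP.and (DefP.lt ?_ ?_) (DefP.all
    (DefP.imp (DefP.lt ?_ ?_) (DefP.imp (DefP.lt ?_ ?_) (DefP.mem hA ?_))))))) <;> fun_prop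

theorem mem_fatFibers_of_infinite {n : ℕ} {A : Set (Fin (n + 1) → ℝ)} (hA : Def L (n + 1) A)
    {x : Fin n → ℝ} (hx : {t : ℝ | (Fin.snoc x t : Fin (n + 1) → ℝ) ∈ A}.Infinite) :
    x ∈ fatFibers A := by
  obtain ⟨a, b, hab, h⟩ := exists_Ioo_of_interior_nonempty (DefP.interior_nonempty_of_infinite
    (L := L) (DefP.mem hA (by fun_prop)) hx)
  exact ⟨a, b, hab, fun t h1 h2 => h ⟨h1, h2⟩⟩

theorem fatFibers_interior_nonempty {n : ℕ} {A : Set (Fin (n + 1) → ℝ)}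
    (hA : (interior A).Nonempty) : (interior (fatFibers A)).Nonempty := by
  obtain ⟨z, hz⟩ := hA
  refine ⟨Fin.init z, mem_interior_iff_mem_nhds.2 ?_⟩
  have hc : Continuous fun w : (Fin n → ℝ) × ℝ => (Fin.snoc w.1 w.2 : Fin (n + 1) → ℝ) := by
    fun_prop
  have h0 : A ∈ 𝓝 (Fin.snoc (Fin.init z) (z (Fin.last n)) : Fin (n + 1) → ℝ) := by
    rw [Fin.snoc_init_self]
    exact mem_interior_iff_mem_nhds.1 hz
  obtain ⟨u, hu, v, hv, huv⟩ := mem_nhds_prod_iff.1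
    (hc.continuousAt (x := (Fin.init z, z (Fin.last n))) h0)
  obtain ⟨a, b, hab, h⟩ := mem_nhds_iff_exists_Ioo_subset.1 hv
  filter_upwards [hu] with x hx
  exact ⟨a, b, hab.1.trans hab.2, fun t h1 h2 => huv (mk_mem_prod hx (h ⟨h1, h2⟩))⟩

theorem exists_interior_closure_nonempty {ι X : Type*} [Countable ι] [TopologicalSpace X]
    [BaireSpace X] {B : ι → Set X} {O : Set X} (hO : IsOpen O) (hne : O.Nonempty)
    (h : O ⊆ ⋃ i, B i) : ∃ i, (interior (closure (B i))).Nonempty := by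
  by_contra! hcon
  have hd : Dense (⋂ i, (closure (B i))ᶜ) :=
    dense_iInter_of_isOpen (fun i => isClosed_closure.isOpen_compl) fun i =>
      interior_eq_empty_iff_dense_compl.1 (hcon i)
  obtain ⟨x, hx, hx'⟩ := hd.inter_open_nonempty O hO hne
  obtain ⟨i, hi⟩ := mem_iUnion.1 (h hx)
  exact mem_iInter.1 hx' i (subset_closure hi)

theorem Def.interior_nonempty_of_closure_aux {n : ℕ}
    (hU : ∀ A B : Set (Fin n → ℝ), Def L n A → Def L n B → (interior (A ∪ B)).Nonempty →
      (interior A).Nonempty ∨ (interior B).Nonempty) {A : Set (Fin n → ℝ)} (hA : Def L n A)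
    (h : (interior (closure A)).Nonempty) : (interior A).Nonempty := by
  obtain ⟨x, hx⟩ := h
  have h1 : (interior (A ∪ (interior (closure A) \ A))).Nonempty :=
    ⟨x, interior_maximal (fun y hy => by
      by_cases h : y ∈ A
      exacts [Or.inl h, Or.inr ⟨hy, h⟩]) isOpen_interior hx⟩
  rcases hU _ _ hA (hA.closure.interior.diff hA) h1 with h | ⟨y, hy⟩
  · exact h
  · obtain ⟨z, hz, hzA⟩ := mem_closure_iff.1 (interior_subset (interior_subset hy).1) _
      isOpen_interior hy
    exact ((interior_subset hz).2 hzA).elim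

theorem fatFibers_aux {n : ℕ}
    (hU : ∀ A B : Set (Fin n → ℝ), Def L n A → Def L n B → (interior (A ∪ B)).Nonempty →
      (interior A).Nonempty ∨ (interior B).Nonempty) {A : Set (Fin (n + 1) → ℝ)}
    (hA : Def L (n + 1) A) (h : (interior (fatFibers A)).Nonempty) : (interior A).Nonempty := by
  let B : ℚ × ℚ → Set (Fin n → ℝ) := fun q =>
    {x | (q.1 : ℝ) < q.2 ∧ ∀ t, (q.1 : ℝ) < t → t < q.2 → (Fin.snoc x t : Fin (n + 1) → ℝ) ∈ A}
  have hB : ∀ q, Def L n (B q) := fun q => by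
    refine DefP.def (DefP.and (DefP.lt ?_ ?_) (DefP.all (DefP.imp (DefP.lt ?_ ?_)
      (DefP.imp (DefP.lt ?_ ?_) (DefP.mem hA ?_))))) <;> fun_prop
  obtain ⟨q, hq⟩ := exists_interior_closure_nonempty (B := B) isOpen_interior h (fun x hx => by
    obtain ⟨a, b, hab, h⟩ := interior_subset hx
    obtain ⟨p, h1, h2⟩ := exists_rat_btwn hab
    obtain ⟨q, h3, h4⟩ := exists_rat_btwn h2
    exact mem_iUnion.2 ⟨(p, q), h3, fun t h5 h6 => h t (h1.trans h5) (h6.trans h4)⟩)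
  obtain ⟨x, hx⟩ := (hB q).interior_nonempty_of_closure_aux hU hq
  have hlt := (interior_subset hx).1
  obtain ⟨t, h1, h2⟩ := exists_between hlt
  have ho : IsOpen {z : Fin (n + 1) → ℝ | Fin.init z ∈ interior (B q) ∧
      z (Fin.last n) ∈ Ioo (q.1 : ℝ) q.2} :=
    (isOpen_interior.preimage (by unfold Fin.init; fun_prop)).inter
      (isOpen_Ioo.preimage (by fun_prop))
  refine ⟨Fin.snoc x t, interior_maximal (fun z hz => ?_) ho
    ⟨by simpa using hx, by simpa using ⟨h1, h2⟩⟩⟩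
  have := (interior_subset hz.1).2 (z (Fin.last n)) hz.2.1 hz.2.2
  rwa [Fin.snoc_init_self] at this

/-- Definable sets with empty interior are closed under finite unions. -/
theorem Def.interior_nonempty_of_union {n : ℕ} {A B : Set (Fin n → ℝ)} (hA : Def L n A)
    (hB : Def L n B) (h : (interior (A ∪ B)).Nonempty) :
    (interior A).Nonempty ∨ (interior B).Nonempty := by
  induction n with
  | zero =>
    obtain ⟨x, hx⟩ := h
    rcases interior_subset hx with h | h
    · exact Or.inl ⟨x, by simpa [(isOpen_discrete A).interior_eq] using h⟩
    · exact Or.inr ⟨x, by simpa [(isOpen_discrete B).interior_eq] using h⟩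
  | succ n ih =>
    have hU : ∀ A B : Set (Fin n → ℝ), Def L n A → Def L n B → (interior (A ∪ B)).Nonempty →
      (interior A).Nonempty ∨ (interior B).Nonempty := fun A B hA hB h => ih hA hB h
    have h1 := fatFibers_interior_nonempty h
    have h2 : fatFibers (A ∪ B) ⊆ fatFibers A ∪ fatFibers B := by
      rintro x ⟨a, b, hab, hx⟩
      have h3 : ({t : ℝ | (Fin.snoc x t : Fin (n + 1) → ℝ) ∈ A} ∪
          {t : ℝ | (Fin.snoc x t : Fin (n + 1) → ℝ) ∈ B}).Infinite :=
        (Ioo_infinite hab).mono fun t ht => hx t ht.1 ht.2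
      rcases infinite_union.1 h3 with h | h
      · exact Or.inl (mem_fatFibers_of_infinite hA h)
      · exact Or.inr (mem_fatFibers_of_infinite hB h)
    rcases hU _ _ hA.fatFibers hB.fatFibers (h1.mono (interior_mono h2)) with h | h
    · exact Or.inl (fatFibers_aux hU hA h)
    · exact Or.inr (fatFibers_aux hU hB h)

theorem Def.interior_nonempty_of_closure {n : ℕ} {A : Set (Fin n → ℝ)} (hA : Def L n A)
    (h : (interior (closure A)).Nonempty) : (interior A).Nonempty :=
  hA.interior_nonempty_of_closure_aux (fun _ _ h1 h2 => h1.interior_nonempty_of_union h2) h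

theorem Def.interior_nonempty_of_fatFibers {n : ℕ} {A : Set (Fin (n + 1) → ℝ)}
    (hA : Def L (n + 1) A) (h : (interior (fatFibers A)).Nonempty) :
    (interior A).Nonempty :=
  fatFibers_aux (fun _ _ h1 h2 => h1.interior_nonempty_of_union h2) hA h

/-- A countable family of definable sets covering a nonempty open set has a member with
nonempty interior. -/
theorem exists_interior_nonempty {ι : Type*} [Countable ι] {n : ℕ} {B : ι → Set (Fin n → ℝ)}
    (hB : ∀ i, Def L n (B i)) {O : Set (Fin n → ℝ)} (hO : IsOpen O) (hne : O.Nonempty)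
    (h : O ⊆ ⋃ i, B i) : ∃ i, (interior (B i)).Nonempty := by
  obtain ⟨i, hi⟩ := exists_interior_closure_nonempty hO hne h
  exact ⟨i, (hB i).interior_nonempty_of_closure hi⟩

/-- A definable set with empty interior. -/
structure Thin (L : FirstOrder.Language) [L.Structure ℝ] {n : ℕ} (s : Set (Fin n → ℝ)) :
    Prop where
  isDef : Def L n s
  interior_eq : interior s = ∅

protected theorem Thin.closure {n : ℕ} {s : Set (Fin n → ℝ)} (h : Thin L s) : Thin L (closure s) :=
  ⟨h.isDef.closure, by
    by_contra hne
    have := h.isDef.interior_nonempty_of_closure (nonempty_iff_ne_empty.2 hne)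
    simp [h.interior_eq] at this⟩

protected theorem Thin.union {n : ℕ} {s t : Set (Fin n → ℝ)} (hs : Thin L s) (ht : Thin L t) :
    Thin L (s ∪ t) :=
  ⟨hs.isDef.union ht.isDef, by
    by_contra hne
    have := hs.isDef.interior_nonempty_of_union ht.isDef (nonempty_iff_ne_empty.2 hne)
    simp [hs.interior_eq, ht.interior_eq] at this⟩

theorem Thin.mono {n : ℕ} {s t : Set (Fin n → ℝ)} (ht : Thin L t) (hs : Def L n s) (h : s ⊆ t) :
    Thin L s :=
  ⟨hs, subset_eq_empty (interior_mono h) ht.interior_eq⟩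

theorem thin_empty {n : ℕ} : Thin L (∅ : Set (Fin n → ℝ)) :=
  ⟨(DefP.const False).def, interior_empty⟩

theorem Thin.iUnion_fin {n k : ℕ} {s : Fin k → Set (Fin n → ℝ)} (h : ∀ i, Thin L (s i)) :
    Thin L (⋃ i, s i) := by
  induction k with
  | zero => simpa using thin_empty
  | succ k ih =>
    rw [show (⋃ i, s i) = s 0 ∪ ⋃ i : Fin k, s i.succ by ext; simp [Fin.exists_fin_succ] ]
    exact (h 0).union (ih fun i => h i.succ)

/-- A definable set contained in a countable union of thin sets is thin. -/
theorem thin_of_subset_iUnion {ι : Type*} [Countable ι] {n : ℕ} {B : ι → Set (Fin n → ℝ)}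
    (hB : ∀ i, Thin L (B i)) {s : Set (Fin n → ℝ)} (hs : Def L n s) (h : s ⊆ ⋃ i, B i) :
    Thin L s :=
  ⟨hs, by
    by_contra hne
    obtain ⟨i, hi⟩ := exists_interior_nonempty (fun i => (hB i).isDef) isOpen_interior
      (nonempty_iff_ne_empty.2 hne) (interior_subset.trans h)
    simp [(hB i).interior_eq] at hi⟩

theorem thin_not_continuousAt {n : ℕ} {f : (Fin n → ℝ) → ℝ} (hf : DefFn L f) :
    Thin L {x | ¬ ContinuousAt f x} := by
  have hlt : ∀ q : ℝ, Def L n {x | f x < q} := fun q => DefP.def (DefP.lt hf (by fun_prop))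
  have hgt : ∀ q : ℝ, Def L n {x | q < f x} := fun q => DefP.def (DefP.lt (by fun_prop) hf)
  have key : ∀ {u v : Set (Fin n → ℝ)}, Def L n u → Def L n v → Disjoint u v →
      Thin L (u ∩ closure v) := by
    intro u v hu hv huv
    refine ⟨hu.inter hv.closure, eq_empty_of_forall_notMem fun x hx => ?_⟩
    obtain ⟨y, hy, hyv⟩ := mem_closure_iff.1 (interior_subset hx).2 _ isOpen_interior hx
    exact huv.notMem_of_mem_left (interior_subset hy).1 hyv
  let B : (ℚ × ℚ) × Bool → Set (Fin n → ℝ) := fun q =>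
    if q.1.1 < q.1.2 then
      if q.2 then {x | f x < q.1.1} ∩ closure {x | q.1.2 < f x}
      else {x | q.1.2 < f x} ∩ closure {x | f x < q.1.1}
    else ∅
  have hB : ∀ q, Thin L (B q) := by
    rintro ⟨⟨p, q⟩, b⟩
    simp only [B]
    split_ifs with h1 h2
    · refine key (hlt _) (hgt _) (disjoint_left.2 fun x h3 h4 => ?_)
      exact absurd (lt_trans (show _ < f x from h4) h3) (not_lt.2 (by exact_mod_cast h1.le))
    · refine key (hgt _) (hlt _) (disjoint_left.2 fun x h4 h3 => ?_)
      exact absurd (lt_trans (show _ < f x from h4) h3) (not_lt.2 (by exact_mod_cast h1.le))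
    · exact thin_empty
  refine thin_of_subset_iUnion hB (DefP.continuousAt (F := fun _ => f) (a := fun x => x)
    (by fun_prop) (by fun_prop)).not.def fun x hx => ?_
  by_contra hcon
  refine hx (tendsto_order.2 ⟨fun a ha => ?_, fun a ha => ?_⟩)
  · obtain ⟨p, h1, h2⟩ := exists_rat_btwn ha
    obtain ⟨q, h3, h4⟩ := exists_rat_btwn h2
    have h5 : x ∉ closure {x | f x < p} := fun h => hcon (mem_iUnion.2 ⟨((p, q), false), by
      simp only [B, if_pos (show p < q by exact_mod_cast h3)]
      exact ⟨h4, h⟩⟩)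
    filter_upwards [isClosed_closure.isOpen_compl.mem_nhds h5] with y hy
    exact h1.trans_le (not_lt.1 fun h => hy (subset_closure h))
  · obtain ⟨p, h1, h2⟩ := exists_rat_btwn ha
    obtain ⟨q, h3, h4⟩ := exists_rat_btwn h2
    have h5 : x ∉ closure {x | q < f x} := fun h => hcon (mem_iUnion.2 ⟨((p, q), true), by
      simp only [B, if_pos (show p < q by exact_mod_cast h3)]
      exact ⟨h1, h⟩⟩)
    filter_upwards [isClosed_closure.isOpen_compl.mem_nhds h5] with y hy
    exact (not_lt.1 fun h => hy (subset_closure h)).trans_lt h4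

end Omin

section Calculus

/-- The linear form with given coefficients. -/
noncomputable def linForm {m : ℕ} (c : Fin m → ℝ) : (Fin m → ℝ) →L[ℝ] ℝ :=
  ∑ i, c i • ContinuousLinearMap.proj i

theorem linForm_apply {m : ℕ} (c v : Fin m → ℝ) : linForm c v = ∑ i, c i * v i := by
  simp [linForm]

theorem linForm_single {m : ℕ} (c : Fin m → ℝ) (i : Fin m) : linForm c (Pi.single i 1) = c i := by
  simp [linForm_apply, Pi.single_apply]

theorem eq_linForm {m : ℕ} (l : (Fin m → ℝ) →L[ℝ] ℝ) :
    l = linForm fun i => l (Pi.single i 1) := by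
  ext v
  rw [linForm_apply]
  have := LinearMap.pi_apply_eq_sum_univ (l : (Fin m → ℝ) →ₗ[ℝ] ℝ) v
  simp only [ContinuousLinearMap.coe_coe] at this
  rw [this]
  refine Finset.sum_congr rfl fun i _ => ?_
  rw [smul_eq_mul, mul_comm]
  congr 2
  ext j
  simp [Pi.single_apply, eq_comm]

theorem contDiff_linForm {m : ℕ} {r : ℕ} : ContDiff ℝ r (linForm : (Fin m → ℝ) → _) := by
  unfold linForm
  exact ContDiff.sum fun i _ => (contDiff_apply ℝ ℝ i).smul contDiff_const

/-- A function with continuous partial derivatives is differentiable. -/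
theorem hasFDerivAt_of_partial {m : ℕ} {f : (Fin m → ℝ) → ℝ} {g : Fin m → (Fin m → ℝ) → ℝ}
    {u : Fin m → ℝ}
    (hd : ∀ i, ∀ᶠ y in 𝓝 u, HasDerivAt (fun t : ℝ => f (y + t • Pi.single i 1)) (g i y) 0)
    (hc : ∀ i, ContinuousAt (g i) u) : HasFDerivAt f (linForm fun i => g i u) u := by
  classical
  have key : ∀ s : Finset (Fin m), ∀ ε > 0, ∀ᶠ h : Fin m → ℝ in 𝓝 0,
      |f (u + fun j => if j ∈ s then h j else 0) - f u - ∑ i ∈ s, g i u * h i| ≤ ε * ‖h‖ := by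
    intro s
    induction s using Finset.induction_on with
    | empty =>
      intro ε hε
      refine Filter.Eventually.of_forall fun h => ?_
      have : (u + fun _ => (0 : ℝ)) = u := by ext; simp
      simp only [Finset.notMem_empty, if_false, this, sub_self, Finset.sum_empty, abs_zero]
      positivity
    | insert i s his ih =>
      intro ε hε
      have h1 := Metric.tendsto_nhds.1 (hc i) (ε / 2) (half_pos hε)
      obtain ⟨δ, hδ, hδ'⟩ := Metric.eventually_nhds_iff_ball.1 (h1.and (hd i))
      filter_upwards [ih (ε / 2) (half_pos hε), Metric.ball_mem_nhds (0 : Fin m → ℝ) hδ]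
        with h hh hhδ
      rw [mem_ball_zero_iff] at hhδ
      set v : Fin m → ℝ := fun j => if j ∈ s then h j else 0 with hv
      have hins : (fun j => if j ∈ insert i s then h j else 0) = v + h i • Pi.single i 1 := by
        ext j
        by_cases hj : j = i
        · subst hj
          simp [hv, his]
        · simp [hv, hj]
      rw [hins, Finset.sum_insert his]
      have hball : ∀ t ∈ uIcc 0 (h i), u + v + t • Pi.single i 1 ∈ Metric.ball u δ := by
        intro t ht
        rw [mem_ball_iff_norm, add_assoc, add_sub_cancel_left]
        refine lt_of_le_of_lt ((pi_norm_le_iff_of_nonneg (norm_nonneg h)).2 fun j => ?_) hhδ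
        by_cases hj : j = i
        · subst hj
          simp only [hv, Pi.add_apply, his, if_false, Pi.smul_apply, Pi.single_eq_same,
            smul_eq_mul, mul_one, zero_add]
          refine le_trans ?_ (norm_le_pi_norm h j)
          rw [Real.norm_eq_abs, Real.norm_eq_abs]
          simpa using abs_sub_left_of_mem_uIcc ht
        · simp only [hv, Pi.add_apply, Pi.smul_apply, smul_eq_mul, Pi.single_eq_of_ne hj, mul_zero,
            add_zero]
          split_ifs
          · exact norm_le_pi_norm h j
          · simp
      have hder : ∀ t ∈ uIcc 0 (h i), HasDerivWithinAt
          (fun t => f (u + v + t • Pi.single i 1) - g i u * t)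
          (g i (u + v + t • Pi.single i 1) - g i u) (uIcc 0 (h i)) t := by
        intro t ht
        have h2 := (hδ' _ (hball t ht)).2
        have h3 : HasDerivAt (fun x => f (u + v + x • Pi.single i 1))
            (g i (u + v + t • Pi.single i 1)) t := by
          have h4 := HasDerivAt.comp_sub_const t t (by simpa using h2)
          refine h4.congr_of_eventuallyEq (Filter.Eventually.of_forall fun x => ?_)
          simp only [sub_smul]
          congr 1
          abel
        have h4 := h3.fun_sub ((hasDerivAt_id' t).const_mul (g i u))
        rw [mul_one] at h4
        exact h4.hasDerivWithinAt
      have h5 := (convex_uIcc 0 (h i)).norm_image_sub_le_of_norm_hasDerivWithin_le hder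
        (C := ε / 2) (fun t ht => by
          rw [← dist_eq_norm]
          exact (hδ' _ (hball t ht)).1.le) left_mem_uIcc right_mem_uIcc
      simp only [zero_smul, add_zero, mul_zero, sub_zero, Real.norm_eq_abs] at h5
      have h6 : |h i| ≤ ‖h‖ := norm_le_pi_norm h i
      have h7 : f (u + (v + h i • Pi.single i 1)) - f u - (g i u * h i + ∑ i ∈ s, g i u * h i) =
          (f (u + v + h i • Pi.single i 1) - g i u * h i - f (u + v)) +
          (f (u + v) - f u - ∑ i ∈ s, g i u * h i) := by rw [add_assoc u v]; ring
      rw [h7]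
      refine (abs_add_le _ _).trans ?_
      nlinarith [mul_le_mul_of_nonneg_left h6 hε.le]
  rw [hasFDerivAt_iff_isLittleO_nhds_zero, Asymptotics.isLittleO_iff]
  intro ε hε
  filter_upwards [key Finset.univ ε hε] with h hh
  simpa [linForm_apply] using hh

end Calculus

section GenericSmooth

variable {L} {α : Type} [Coord α] [hF : Fact (ExpandsOrderedField L)]

theorem DefFn.linForm {m : ℕ} {c v : α → Fin m → ℝ} (hc : DefFn L c) (hv : DefFn L v) :
    DefFn L fun x => linForm (c x) (v x) := by
  simp only [linForm_apply]
  fun_prop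

theorem DefP.hasFDerivAt {m : ℕ} {F : α → (Fin m → ℝ) → ℝ} {a c : α → Fin m → ℝ}
    (hF' : DefFn L fun z : α × (Fin m → ℝ) => F z.1 z.2) (ha : DefFn L a) (hc : DefFn L c) :
    DefP L fun x => HasFDerivAt (F x) (Paper.linForm (c x)) (a x) := by
  simp only [hasFDerivAt_iff_isLittleO, Asymptotics.isLittleO_iff]
  have h1 : DefFn L fun z : ((α × ℝ) × (Fin m → ℝ)) => F z.1.1 z.2 :=
    hF'.comp (f := fun z : ((α × ℝ) × (Fin m → ℝ)) => (z.1.1, z.2)) (by fun_prop)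
  have h2 : DefFn L fun z : ((α × ℝ) × (Fin m → ℝ)) => F z.1.1 (a z.1.1) :=
    hF'.comp (f := fun z : ((α × ℝ) × (Fin m → ℝ)) => (z.1.1, a z.1.1)) (by fun_prop)
  have h3 : DefFn L fun z : ((α × ℝ) × (Fin m → ℝ)) =>
      Paper.linForm (c z.1.1) (z.2 - a z.1.1) := DefFn.linForm (by fun_prop) (by fun_prop)
  simp only [Real.norm_eq_abs (F _ _ - _ - _)]
  refine DefP.all (DefP.imp (DefP.lt ?_ ?_) (DefP.eventually_nhds (DefP.le ?_ ?_) ?_)) <;> fun_prop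

theorem differentiableAt_iff_exists_linForm {m : ℕ} {f : (Fin m → ℝ) → ℝ} {a : Fin m → ℝ} :
    DifferentiableAt ℝ f a ↔ ∃ c, HasFDerivAt f (linForm c) a :=
  ⟨fun ⟨l, h⟩ => ⟨_, eq_linForm l ▸ h⟩, fun ⟨_, h⟩ => h.differentiableAt⟩

theorem DefP.differentiableAt {m : ℕ} {F : α → (Fin m → ℝ) → ℝ} {a : α → Fin m → ℝ}
    (hF' : DefFn L fun z : α × (Fin m → ℝ) => F z.1 z.2) (ha : DefFn L a) :
    DefP L fun x => DifferentiableAt ℝ (F x) (a x) := by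
  simp only [differentiableAt_iff_exists_linForm]
  refine DefP.ex (DefP.hasFDerivAt (F := fun z : α × (Fin m → ℝ) => F z.1) ?_ ?_ ?_)
  · exact hF'.comp (f := fun z : (α × (Fin m → ℝ)) × (Fin m → ℝ) => (z.1.1, z.2)) (by fun_prop)
  all_goals fun_prop

theorem DefFn.fderiv_single {m : ℕ} {F : α → (Fin m → ℝ) → ℝ} {a : α → Fin m → ℝ}
    (hF' : DefFn L fun z : α × (Fin m → ℝ) => F z.1 z.2) (ha : DefFn L a) (i : Fin m) :
    DefFn L fun x => fderiv ℝ (F x) (a x) (Pi.single i 1) := by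
  have h : DefFn L fun x => (fun i => fderiv ℝ (F x) (a x) (Pi.single i 1)) := by
    refine DefFn.choose (b := 0)
      (p := fun x c => HasFDerivAt (F x) (Paper.linForm c) (a x)) ?_ ?_ ?_ ?_
    · refine DefP.hasFDerivAt (F := fun z : α × (Fin m → ℝ) => F z.1) ?_ ?_ ?_
      · exact hF'.comp (f := fun z : (α × (Fin m → ℝ)) × (Fin m → ℝ) => (z.1.1, z.2))
          (by fun_prop)
      all_goals fun_prop
    · intro x h
      rw [← eq_linForm]
      exact (differentiableAt_iff_exists_linForm.2 h).hasFDerivAt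
    · intro x h
      rw [← differentiableAt_iff_exists_linForm] at h
      ext i
      simp [fderiv_zero_of_not_differentiableAt h]
    · intro x c c' h h'
      ext i
      rw [← linForm_single c, h.unique h', linForm_single]
  exact (defFn_apply i).comp h

theorem contDiffAt_zero_iff {E F : Type*} [NormedAddCommGroup E] [NormedSpace ℝ E]
    [NormedAddCommGroup F] [NormedSpace ℝ F] {f : E → F} {x : E} :
    ContDiffAt ℝ 0 f x ↔ ∀ᶠ y in 𝓝 x, ContinuousAt f y := by
  rw [contDiffAt_zero]
  constructor
  · rintro ⟨u, hu, h⟩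
    filter_upwards [eventually_mem_nhds_iff.2 hu] with y hy using h.continuousAt hy
  · exact fun h => ⟨_, h, fun y hy => ContinuousAt.continuousWithinAt hy⟩

theorem contDiffAt_succ_iff_partial {m r : ℕ} {f : (Fin m → ℝ) → ℝ} {x : Fin m → ℝ} :
    ContDiffAt ℝ (r + 1 : ℕ) f x ↔ (∀ᶠ y in 𝓝 x, DifferentiableAt ℝ f y) ∧
      ∀ i, ContDiffAt ℝ r (fun y => fderiv ℝ f y (Pi.single i 1)) x := by
  rw [Nat.cast_add, Nat.cast_one, contDiffAt_succ_iff_hasFDerivAt]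
  constructor
  · rintro ⟨f', ⟨u, hu, hf⟩, hf'⟩
    refine ⟨Filter.mem_of_superset hu fun y hy => (hf y hy).differentiableAt, fun i => ?_⟩
    refine (hf'.clm_apply (contDiffAt_const (c := Pi.single i 1))).congr_of_eventuallyEq ?_
    filter_upwards [hu] with y hy
    rw [(hf y hy).fderiv]
  · rintro ⟨h1, h2⟩
    refine ⟨fderiv ℝ f, ⟨_, h1, fun y hy => DifferentiableAt.hasFDerivAt hy⟩, ?_⟩
    have : fderiv ℝ f = fun y => Paper.linForm fun i => fderiv ℝ f y (Pi.single i 1) :=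
      funext fun y => eq_linForm _
    rw [this]
    exact contDiff_linForm.contDiffAt.comp x (contDiffAt_pi.2 h2)

theorem DefP.contDiffAt {m : ℕ} (r : ℕ) {F : α → (Fin m → ℝ) → ℝ} {a : α → Fin m → ℝ}
    (hF' : DefFn L fun z : α × (Fin m → ℝ) => F z.1 z.2) (ha : DefFn L a) :
    DefP L fun x => ContDiffAt ℝ r (F x) (a x) := by
  have hF2 : DefFn L fun z : (α × (Fin m → ℝ)) × (Fin m → ℝ) => F z.1.1 z.2 :=
    hF'.comp (f := fun z : (α × (Fin m → ℝ)) × (Fin m → ℝ) => (z.1.1, z.2)) (by fun_prop)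
  induction r generalizing F with
  | zero =>
    simp only [Nat.cast_zero, contDiffAt_zero_iff]
    exact DefP.eventually_nhds (DefP.continuousAt (F := fun z : α × (Fin m → ℝ) => F z.1)
      hF2 (by fun_prop)) ha
  | succ r ih =>
    simp only [contDiffAt_succ_iff_partial]
    refine DefP.and (DefP.eventually_nhds (DefP.differentiableAt
      (F := fun z : α × (Fin m → ℝ) => F z.1) hF2 (by fun_prop)) ha)
      (DefP.all_finite fun i => ih ?_ ?_)
    · exact DefFn.fderiv_single (F := fun z : α × (Fin m → ℝ) => F z.1) hF2 (by fun_prop) i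
    · have := DefFn.fderiv_single (F := fun z : α × (Fin m → ℝ) => F z.1) hF2
        (a := fun z => z.2) (by fun_prop) i
      exact this.comp (f := fun z : (α × (Fin m → ℝ)) × (Fin m → ℝ) => (z.1.1, z.2)) (by fun_prop)

theorem DefP.contDiffAt_pi {m k : ℕ} (r : ℕ) {F : α → (Fin m → ℝ) → (Fin k → ℝ)}
    {a : α → Fin m → ℝ} (hF' : DefFn L fun z : α × (Fin m → ℝ) => F z.1 z.2) (ha : DefFn L a) :
    DefP L fun x => ContDiffAt ℝ r (F x) (a x) := by
  simp only [_root_.contDiffAt_pi]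
  exact DefP.all_finite fun i => DefP.contDiffAt r (F := fun x y => F x y i)
    ((defFn_apply i).comp hF') ha

variable [hO : Fact (LocallyOMinimal L)]

theorem DefP.exists_Ioo_subset {p q : ℝ → Prop} (hp : DefP L p) (hq : DefP L q) {a b : ℝ}
    (hab : a < b) (h : ∀ t ∈ Ioo a b, p t ∨ q t) : ∃ c d, a ≤ c ∧ c < d ∧ d ≤ b ∧
      ((∀ t ∈ Ioo c d, p t) ∨ ∀ t ∈ Ioo c d, q t) := by
  have hI : DefP L fun t => t ∈ Ioo a b :=
    DefP.and (DefP.lt (by fun_prop) (by fun_prop)) (DefP.lt (by fun_prop) (by fun_prop))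
  have key : ∀ {p : ℝ → Prop}, DefP L p → {t | p t ∧ t ∈ Ioo a b}.Infinite →
      ∃ c d, a ≤ c ∧ c < d ∧ d ≤ b ∧ ∀ t ∈ Ioo c d, p t := by
    intro p hp hinf
    obtain ⟨c, d, hcd, h⟩ := exists_Ioo_of_interior_nonempty
      ((hp.and hI).interior_nonempty_of_infinite hinf)
    have h' := (Ioo_subset_Ioo_iff hcd).1 fun t ht => (h ht).2
    exact ⟨c, d, h'.1, hcd, h'.2, fun t ht => (h ht).1⟩
  have h3 : ({t | p t ∧ t ∈ Ioo a b} ∪ {t | q t ∧ t ∈ Ioo a b}).Infinite :=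
    (Ioo_infinite hab).mono fun t ht => (h t ht).imp (⟨·, ht⟩) (⟨·, ht⟩)
  rcases infinite_union.1 h3 with h | h
  · obtain ⟨c, d, h1, h2, h3, h4⟩ := key hp h
    exact ⟨c, d, h1, h2, h3, Or.inl h4⟩
  · obtain ⟨c, d, h1, h2, h3, h4⟩ := key hq h
    exact ⟨c, d, h1, h2, h3, Or.inr h4⟩

theorem exists_Ioo_continuousAt {f : ℝ → ℝ} (hf : DefFn L f) {a b : ℝ} (hab : a < b) :
    ∃ c d, a ≤ c ∧ c < d ∧ d ≤ b ∧ ∀ t ∈ Ioo c d, ContinuousAt f t := by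
  have hiff : ∀ t : ℝ, ContinuousAt (fun y : Fin 1 → ℝ => f (y 0)) (fun _ => t) ↔
      ContinuousAt f t := by
    intro t
    constructor
    · intro h
      exact ContinuousAt.comp (f := fun t : ℝ => fun _ : Fin 1 => t) h (by fun_prop)
    · intro h
      exact ContinuousAt.comp (g := f) (f := fun y : Fin 1 → ℝ => y 0) h
        (continuous_apply 0).continuousAt
  have hp : DefP L fun t => ContinuousAt f t :=
    (DefP.continuousAt (F := fun (_ : ℝ) (y : Fin 1 → ℝ) => f (y 0)) (a := fun t _ => t)
      (by fun_prop) (by fun_prop)).congr fun t => (hiff t).symm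
  obtain ⟨c, d, h1, h2, h3, h | h⟩ := DefP.exists_Ioo_subset hp hp.not hab fun t _ => em _
  · exact ⟨c, d, h1, h2, h3, h⟩
  · exfalso
    have ho : IsOpen {y : Fin 1 → ℝ | y 0 ∈ Ioo c d} := isOpen_Ioo.preimage (by fun_prop)
    obtain ⟨t, ht⟩ := exists_between h2
    have hsub : {y : Fin 1 → ℝ | y 0 ∈ Ioo c d} ⊆
        {x | ¬ ContinuousAt (fun y : Fin 1 → ℝ => f (y 0)) x} := by
      intro y hy h'
      have hy' : y = fun _ => y 0 := funext fun i => by rw [Subsingleton.elim i 0]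
      rw [hy'] at h'
      exact h _ hy ((hiff _).1 h')
    have := interior_maximal hsub ho (show (fun _ => t : Fin 1 → ℝ) ∈ _ from ht)
    rw [(thin_not_continuousAt (L := L) (by fun_prop)).interior_eq] at this
    exact this

theorem monotoneOn_of_eventually_le {f : ℝ → ℝ} {a b : ℝ} (hc : ∀ t ∈ Ioo a b, ContinuousAt f t)
    (h : ∀ t ∈ Ioo a b, ∀ᶠ s in 𝓝[>] t, f t ≤ f s) : MonotoneOn f (Ioo a b) := by
  intro x hx y hy hxy
  have hsub : Icc x y ⊆ Ioo a b := Icc_subset_Ioo hx.1 hy.2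
  have hcl : IsClosed ({t | f x ≤ f t} ∩ Icc x y) := by
    rw [inter_comm]
    exact ContinuousOn.preimage_isClosed_of_isClosed (t := Ici (f x))
      (fun t ht => (hc t (hsub ht)).continuousWithinAt) isClosed_Icc isClosed_Ici
  refine hcl.Icc_subset_of_forall_mem_nhdsWithin (le_refl (f x)) (fun t ht => ?_) ⟨hxy, le_rfl⟩
  filter_upwards [h t (hsub ⟨ht.2.1, ht.2.2.le⟩)] with s hs
  exact le_trans (show f x ≤ f t from ht.1) hs

theorem MonotoneOn.exists_differentiableAt {f : ℝ → ℝ} {a b : ℝ} (hab : a < b)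
    (h : MonotoneOn f (Ioo a b)) : ∃ t ∈ Ioo a b, DifferentiableAt ℝ f t := by
  have := h.ae_differentiableWithinAt_of_mem
  by_contra! hcon
  have h0 : ∀ᵐ t : ℝ, t ∉ Ioo a b := by
    filter_upwards [this] with t ht hI
    exact hcon t hI ((ht hI).differentiableAt (isOpen_Ioo.mem_nhds hI))
  have h1 : MeasureTheory.volume (Ioo a b) = 0 := by
    have := MeasureTheory.ae_iff.1 h0
    simpa only [not_not, ofPred_mem_eq] using this
  rw [Real.volume_Ioo, ENNReal.ofReal_eq_zero] at h1
  linarith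

theorem exists_differentiableAt {f : ℝ → ℝ} (hf : DefFn L f) {a b : ℝ} (hab : a < b) :
    ∃ t ∈ Ioo a b, DifferentiableAt ℝ f t := by
  obtain ⟨c, d, h1, h2, h3, hc⟩ := exists_Ioo_continuousAt hf hab
  have hR : ∀ {f : ℝ → ℝ}, DefFn L f → DefP L fun t => ∀ᶠ s in 𝓝[>] t, f t ≤ f s := by
    intro f hf
    have : ∀ t : ℝ, (∀ᶠ s in 𝓝[>] t, f t ≤ f s) ↔ ∃ u, t < u ∧ ∀ s, t < s → s < u → f t ≤ f s := by
      intro t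
      rw [Filter.Eventually, mem_nhdsGT_iff_exists_Ioo_subset]
      simp [subset_def]
    simp only [this]
    refine DefP.ex (DefP.and (DefP.lt ?_ ?_) (DefP.all (DefP.imp (DefP.lt ?_ ?_)
      (DefP.imp (DefP.lt ?_ ?_) (DefP.le ?_ ?_))))) <;> fun_prop
  obtain ⟨c', d', h4, h5, h6, h⟩ := DefP.exists_Ioo_subset (hR hf) (hR hf.neg) h2 (fun t _ => by
    rcases (DefP.le (L := L) (DefFn.const (f t)) hf).eventually_or t with h | h
    · exact Or.inl h
    · right
      filter_upwards [h] with s hs using neg_le_neg (not_le.1 hs).le)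
  have hsub : Ioo c' d' ⊆ Ioo a b := Ioo_subset_Ioo (h1.trans h4) (h6.trans h3)
  have hc' : ∀ t ∈ Ioo c' d', ContinuousAt f t := fun t ht =>
    hc t ⟨h4.trans_lt ht.1, ht.2.trans_le h6⟩
  rcases h with h | h
  · obtain ⟨t, ht, h⟩ := MonotoneOn.exists_differentiableAt h5 (monotoneOn_of_eventually_le hc' h)
    exact ⟨t, hsub ht, h⟩
  · obtain ⟨t, ht, h⟩ := MonotoneOn.exists_differentiableAt h5
      (monotoneOn_of_eventually_le (fun t ht => (hc' t ht).neg) h)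
    exact ⟨t, hsub ht, by simpa using h.neg⟩

/-- A definable function is `C^r` off a thin set. -/
theorem thin_not_contDiffAt {m : ℕ} (r : ℕ) {f : (Fin m → ℝ) → ℝ} (hf : DefFn L f) :
    Thin L {x | ¬ ContDiffAt ℝ r f x} := by
  induction r generalizing f with
  | zero =>
    have : {x | ¬ ContDiffAt ℝ (0 : ℕ) f x} = closure {x | ¬ ContinuousAt f x} := by
      ext x
      simp only [Nat.cast_zero, contDiffAt_zero_iff, closure_eq_compl_interior_compl,
        mem_compl_iff, mem_interior_iff_mem_nhds, mem_ofPred_eq, Filter.Eventually, compl_ofPred,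
        not_not]
    rw [this]
    exact (thin_not_continuousAt hf).closure
  | succ r ih =>
    let H : Fin m → (Fin m → ℝ) → (Fin 1 → ℝ) → ℝ := fun i y t => f (y + t 0 • Pi.single i 1)
    have hH : ∀ i, DefFn L fun z : (Fin m → ℝ) × (Fin 1 → ℝ) => H i z.1 z.2 := fun i => by
      simp only [H]
      fun_prop
    have hder : ∀ i y, DifferentiableAt ℝ (H i y) 0 → HasDerivAt
        (fun t : ℝ => f (y + t • Pi.single i 1)) (fderiv ℝ (H i y) 0 (Pi.single 0 1)) 0 := by
      intro i y h
      have h1 : HasDerivAt (fun t : ℝ => fun _ : Fin 1 => t) (Pi.single 0 1) 0 :=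
        hasDerivAt_pi.2 fun j => by
          rw [Subsingleton.elim j 0]
          simpa using hasDerivAt_id' (0 : ℝ)
      exact HasFDerivAt.comp_hasDerivAt (f := fun t : ℝ => fun _ : Fin 1 => t) 0 h.hasFDerivAt h1
    have hN : ∀ i, Thin L {y | ¬ DifferentiableAt ℝ (H i y) 0} := by
      intro i
      refine ⟨(DefP.differentiableAt (hH i) (by fun_prop)).not.def,
        eq_empty_of_forall_notMem fun y hy => ?_⟩
      have hcont : Continuous fun t : ℝ => y + t • (Pi.single i 1 : Fin m → ℝ) := by fun_prop
      have h1 : ∀ᶠ t : ℝ in 𝓝 0, y + t • (Pi.single i 1 : Fin m → ℝ) ∈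
          {y | ¬ DifferentiableAt ℝ (H i y) 0} :=
        hcont.continuousAt (by simpa using mem_interior_iff_mem_nhds.1 hy)
      obtain ⟨a, b, hab, h2⟩ := mem_nhds_iff_exists_Ioo_subset.1 h1
      obtain ⟨t, ht, hd⟩ := exists_differentiableAt (L := L)
        (f := fun t => f (y + t • (Pi.single i 1 : Fin m → ℝ))) (by fun_prop) (hab.1.trans hab.2)
      refine h2 ht ?_
      have h3 : H i (y + t • Pi.single i 1) = (fun t => f (y + t • (Pi.single i 1 : Fin m → ℝ))) ∘
          fun s : Fin 1 → ℝ => t + s 0 := by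
        ext s
        simp only [H, Function.comp, add_smul, add_assoc]
      rw [h3]
      exact DifferentiableAt.comp _ (by simpa using hd) (by fun_prop)
    let g : Fin m → (Fin m → ℝ) → ℝ := fun i y => fderiv ℝ (H i y) 0 (Pi.single 0 1)
    have hg : ∀ i, DefFn L (g i) := fun i => DefFn.fderiv_single (hH i) (by fun_prop) 0
    have hbad := (Thin.iUnion_fin fun i => (hN i).closure).union
      (Thin.iUnion_fin fun i => ih (hg i))
    refine hbad.mono (DefP.contDiffAt (r + 1) (F := fun _ => f) (a := fun x => x)
      (by fun_prop) (by fun_prop)).not.def fun x hx => ?_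
    by_contra hcon
    simp only [mem_union, mem_iUnion, not_or, not_exists, mem_ofPred_eq, not_not] at hcon
    refine hx ?_
    have h1 : ∀ i, ∀ᶠ y in 𝓝 x, HasDerivAt (fun t : ℝ => f (y + t • Pi.single i 1)) (g i y) 0 := by
      intro i
      filter_upwards [isClosed_closure.isOpen_compl.mem_nhds (hcon.1 i)] with y hy
      exact hder i y (by_contra fun h => hy (subset_closure h))
    have h2 : ∀ i, ∀ᶠ y in 𝓝 x, ContinuousAt (g i) y := fun i =>
      contDiffAt_zero_iff.1 ((hcon.2 i).of_le (by simp))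
    have h3 : ∀ᶠ y in 𝓝 x, HasFDerivAt f (Paper.linForm fun i => g i y) y := by
      filter_upwards [Filter.eventually_all.2 fun i => (h1 i).eventually_nhds,
        Filter.eventually_all.2 h2] with y hy1 hy2
      exact hasFDerivAt_of_partial hy1 hy2
    refine contDiffAt_succ_iff_partial.2 ⟨h3.mono fun y hy => hy.differentiableAt, fun i => ?_⟩
    refine (hcon.2 i).congr_of_eventuallyEq ?_
    filter_upwards [h3] with y hy
    rw [hy.fderiv, linForm_single]

theorem thin_not_contDiffAt_pi {m k : ℕ} (r : ℕ) {f : (Fin m → ℝ) → (Fin k → ℝ)}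
    (hf : DefFn L f) : Thin L {x | ¬ ContDiffAt ℝ r f x} := by
  have h := Thin.iUnion_fin fun i : Fin k => thin_not_contDiffAt (L := L) r
    (f := fun x => f x i) (by fun_prop)
  convert h using 1
  ext x
  simp [contDiffAt_pi]

end GenericSmooth

section Projections

variable {m k : ℕ}

theorem continuous_coordProj (σ : Fin k → Fin m) :
    Continuous (coordProj k σ : (Fin m → ℝ) → (Fin k → ℝ)) := by
  unfold coordProj
  fun_prop

theorem contDiff_coordProj {r : WithTop ℕ∞} (σ : Fin k → Fin m) :
    ContDiff ℝ r (coordProj k σ : (Fin m → ℝ) → (Fin k → ℝ)) :=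
  contDiff_pi.2 fun i => contDiff_apply ℝ ℝ (σ i)

theorem dist_coordProj_le (σ : Fin k → Fin m) (x y : Fin m → ℝ) :
    dist (coordProj k σ x) (coordProj k σ y) ≤ dist x y :=
  (dist_pi_le_iff dist_nonneg).2 fun i => dist_le_pi_dist x y (σ i)

theorem coordProj_snoc (σ : Fin k → Fin m) (j : Fin m) (x : Fin m → ℝ) :
    coordProj (k + 1) (Fin.snoc σ j : Fin (k + 1) → Fin m) x =
      Fin.snoc (coordProj k σ x) (x j) := by
  ext i
  induction i using Fin.lastCases <;> simp [coordProj]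

variable {L} {α : Type} [Coord α]

@[fun_prop]
theorem DefFn.coordProj {f : α → Fin m → ℝ} (hf : DefFn L f) (σ : Fin k → Fin m) :
    DefFn L fun x => coordProj k σ (f x) := by
  unfold Paper.coordProj
  fun_prop

/-- All coordinate projections of `A` to `ℝᵏ` are definable and have empty interior. -/
def DimLt (L : FirstOrder.Language) [L.Structure ℝ] (k : ℕ) (A : Set (Fin m → ℝ)) : Prop :=
  ∀ σ : Fin k → Fin m, Thin L (coordProj k σ '' A)

theorem DimLt.eq_empty {A : Set (Fin m → ℝ)} (h : DimLt L 0 A) : A = ∅ := by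
  have := (h Fin.elim0).interior_eq
  rw [(isOpen_discrete _).interior_eq, image_eq_empty] at this
  exact this

theorem thin_image_of_not_injective {A : Set (Fin m → ℝ)} (hA : Def L m A) {σ : Fin k → Fin m}
    (hσ : ¬ Function.Injective σ) : Thin L (coordProj k σ '' A) := by
  refine ⟨hA.image (by fun_prop), eq_empty_of_forall_notMem fun x hx => ?_⟩
  simp only [Function.Injective, not_forall] at hσ
  obtain ⟨i, j, hij, hne⟩ := hσ
  have hcont : Continuous fun t : ℝ => x + t • (Pi.single i 1 : Fin k → ℝ) := by fun_prop
  have h1 : ∀ᶠ t : ℝ in 𝓝 0, x + t • (Pi.single i 1 : Fin k → ℝ) ∈ coordProj k σ '' A :=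
    hcont.continuousAt (by simpa using mem_interior_iff_mem_nhds.1 hx)
  have h0 : ∀ y ∈ coordProj k σ '' A, y i = y j := by
    rintro _ ⟨a, -, rfl⟩
    simp [coordProj, hij]
  obtain ⟨t, ht, ht0⟩ := ((h1.filter_mono nhdsWithin_le_nhds).and self_mem_nhdsWithin :
    ∀ᶠ t : ℝ in 𝓝[≠] 0, _ ∧ t ∈ ({0}ᶜ : Set ℝ)).exists
  have h2 := h0 _ ht
  have h3 := h0 _ (interior_subset hx)
  simp only [Pi.add_apply, Pi.smul_apply, Pi.single_eq_same, smul_eq_mul, mul_one,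
    Pi.single_eq_of_ne (Ne.symm hne), mul_zero, add_zero] at h2
  exact ht0 (by rw [mem_singleton_iff]; linarith)

theorem dimLt_succ_self {A : Set (Fin m → ℝ)} (hA : Def L m A) : DimLt L (m + 1) A := fun σ =>
  thin_image_of_not_injective hA fun h => by simpa using Fintype.card_le_of_injective σ h

theorem Thin.dimLt {A : Set (Fin m → ℝ)} (hA : Thin L A) : DimLt L m A := by
  intro σ
  by_cases hσ : Function.Injective σ
  · refine ⟨hA.isDef.image (by fun_prop), eq_empty_of_forall_notMem fun x hx => ?_⟩
    have hs : Function.Surjective σ := Finite.surjective_of_injective hσ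
    have hinj : Function.Injective (coordProj m σ) := by
      intro y z h
      ext i
      obtain ⟨j, rfl⟩ := hs i
      exact congrFun h j
    obtain ⟨y, -, hy⟩ := interior_subset hx
    have hsub : coordProj m σ ⁻¹' interior (coordProj m σ '' A) ⊆ A := by
      intro z hz
      obtain ⟨w, hw, hwz⟩ := interior_subset hz
      rwa [← hinj hwz]
    have := interior_maximal hsub (isOpen_interior.preimage (continuous_coordProj σ))
      (show coordProj m σ y ∈ interior (coordProj m σ '' A) by rwa [hy])
    rwa [hA.interior_eq] at this
  · exact thin_image_of_not_injective hA.isDef hσ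

end Projections

section RegularPoints

variable {m k : ℕ}

/-- Near `a`, the set `A` is the graph of a `C^r` section of the coordinate projection given by
`σ`, along which `f` is `C^r`. -/
def RegAt (r : ℕ) (A : Set (Fin m → ℝ)) (σ : Fin k → Fin m) (f : (Fin m → ℝ) → ℝ)
    (a : Fin m → ℝ) : Prop :=
  a ∈ A ∧ ∃ s : (Fin k → ℝ) → (Fin m → ℝ), ContDiffAt ℝ r s (coordProj k σ a) ∧
    ContDiffAt ℝ r (fun x => f (s x)) (coordProj k σ a) ∧ s (coordProj k σ a) = a ∧
    (∀ᶠ x in 𝓝 (coordProj k σ a), s x ∈ A ∧ coordProj k σ (s x) = x) ∧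
    ∀ᶠ b in 𝓝 a, b ∈ A → b = s (coordProj k σ b)

theorem RegAt.eventually {r : ℕ} {A : Set (Fin m → ℝ)} {σ : Fin k → Fin m}
    {f : (Fin m → ℝ) → ℝ} {a : Fin m → ℝ} (h : RegAt r A σ f a) :
    ∀ᶠ b in 𝓝 a, b ∈ A → RegAt r A σ f b := by
  obtain ⟨-, s, h1, h2, h3, h4, h5⟩ := h
  have hc := (continuous_coordProj σ).continuousAt (x := a)
  filter_upwards [hc.eventually (h1.eventually (by simp)), hc.eventually (h2.eventually (by simp)),
    h5, hc.eventually h4.eventually_nhds, h5.eventually_nhds] with b b1 b2 b3 b4 b5 hb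
  exact ⟨hb, s, b1, b2, (b3 hb).symm, b4, b5⟩

open Classical in
/-- The point of `A` over `x` in the ball `B(c, δ)`, if there is exactly one. -/
noncomputable def localSection (A : Set (Fin m → ℝ)) (σ : Fin k → Fin m) (c : Fin m → ℝ) (δ : ℝ)
    (x : Fin k → ℝ) : Fin m → ℝ :=
  if h : ∃ b, (b ∈ A ∧ dist b c < δ ∧ coordProj k σ b = x) ∧
    ∀ b', b' ∈ A → dist b' c < δ → coordProj k σ b' = x → b' = b then h.choose else 0

theorem localSection_eq {A : Set (Fin m → ℝ)} {σ : Fin k → Fin m} {c : Fin m → ℝ} {δ : ℝ}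
    {x : Fin k → ℝ} {b : Fin m → ℝ} (h : b ∈ A ∧ dist b c < δ ∧ coordProj k σ b = x)
    (hu : ∀ b', b' ∈ A → dist b' c < δ → coordProj k σ b' = x → b' = b) :
    localSection A σ c δ x = b := by
  have h' : ∃ b, (b ∈ A ∧ dist b c < δ ∧ coordProj k σ b = x) ∧
    ∀ b', b' ∈ A → dist b' c < δ → coordProj k σ b' = x → b' = b := ⟨b, h, hu⟩
  rw [localSection, dif_pos h']
  exact hu _ h'.choose_spec.1.1 h'.choose_spec.1.2.1 h'.choose_spec.1.2.2

theorem RegAt.exists_localSection {r : ℕ} {A : Set (Fin m → ℝ)} {σ : Fin k → Fin m}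
    {f : (Fin m → ℝ) → ℝ} {a : Fin m → ℝ} (h : RegAt r A σ f a) :
    ∃ δ > 0, ContDiffAt ℝ r (localSection A σ a δ) (coordProj k σ a) ∧
    ContDiffAt ℝ r (fun x => f (localSection A σ a δ x)) (coordProj k σ a) ∧
    localSection A σ a δ (coordProj k σ a) = a ∧
    (∀ᶠ x in 𝓝 (coordProj k σ a), localSection A σ a δ x ∈ A ∧
      coordProj k σ (localSection A σ a δ x) = x) ∧
    ∀ᶠ b in 𝓝 a, b ∈ A → b = localSection A σ a δ (coordProj k σ b) := by
  obtain ⟨-, s, h1, h2, h3, h4, h5⟩ := h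
  obtain ⟨δ, hδ, hδ'⟩ := Metric.eventually_nhds_iff.1 h5
  have hs : ∀ᶠ x in 𝓝 (coordProj k σ a), dist (s x) a < δ := by
    have := Metric.tendsto_nhds.1 h1.continuousAt δ hδ
    rwa [h3] at this
  have heq : ∀ᶠ x in 𝓝 (coordProj k σ a), localSection A σ a δ x = s x := by
    filter_upwards [hs, h4] with x hx1 hx2
    refine localSection_eq ⟨hx2.1, hx1, hx2.2⟩ fun b' hb' hd hb'x => ?_
    rw [hδ' hd hb', hb'x]
  refine ⟨δ, hδ, h1.congr_of_eventuallyEq heq, h2.congr_of_eventuallyEq ?_, ?_, ?_, ?_⟩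
  · filter_upwards [heq] with x hx
    rw [hx]
  · rw [heq.self_of_nhds, h3]
  · filter_upwards [heq, h4] with x hx h
    rwa [hx]
  · filter_upwards [h5, (continuous_coordProj σ).continuousAt.eventually heq] with b hb hx hbA
    rw [hx]
    exact hb hbA

variable {L} {α : Type} [Coord α] [hF : Fact (ExpandsOrderedField L)]

theorem DefFn.localSection {A : Set (Fin m → ℝ)} (hA : Def L m A) (σ : Fin k → Fin m)
    {c : α → Fin m → ℝ} {δ : α → ℝ} {x : α → Fin k → ℝ} (hc : DefFn L c) (hδ : DefFn L δ)
    (hx : DefFn L x) : DefFn L fun z => localSection A σ (c z) (δ z) (x z) := by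
  refine DefFn.choose (b := 0)
    (p := fun z b => (b ∈ A ∧ dist b (c z) < δ z ∧ Paper.coordProj k σ b = x z) ∧
    ∀ b', b' ∈ A → dist b' (c z) < δ z → Paper.coordProj k σ b' = x z → b' = b) ?_ ?_ ?_ ?_
  · refine DefP.and (DefP.and (DefP.mem hA ?_) (DefP.and (DefP.lt ?_ ?_) (DefP.eq ?_ ?_)))
      (DefP.all (DefP.imp (DefP.mem hA ?_) (DefP.imp (DefP.lt ?_ ?_)
        (DefP.imp (DefP.eq ?_ ?_) (DefP.eq ?_ ?_))))) <;> fun_prop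
  · intro z h
    rw [Paper.localSection, dif_pos h]
    exact h.choose_spec
  · intro z h
    rw [Paper.localSection, dif_neg h]
  · intro z b b' h h'
    exact h'.2 b h.1.1 h.1.2.1 h.1.2.2

theorem Def.regAt {r : ℕ} {A : Set (Fin m → ℝ)} (hA : Def L m A) (σ : Fin k → Fin m)
    {f : (Fin m → ℝ) → ℝ} (hf : DefFn L f) : Def L m {a | RegAt r A σ f a} := by
  have hiff : ∀ a, RegAt r A σ f a ↔ a ∈ A ∧ ∃ δ : ℝ, 0 < δ ∧
      (ContDiffAt ℝ r (localSection A σ a δ) (coordProj k σ a) ∧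
      ContDiffAt ℝ r (fun x => f (localSection A σ a δ x)) (coordProj k σ a) ∧
      localSection A σ a δ (coordProj k σ a) = a ∧
      (∀ᶠ x in 𝓝 (coordProj k σ a), localSection A σ a δ x ∈ A ∧
        coordProj k σ (localSection A σ a δ x) = x) ∧
      ∀ᶠ b in 𝓝 a, b ∈ A → b = localSection A σ a δ (coordProj k σ b)) := fun a =>
    ⟨fun h => ⟨h.1, h.exists_localSection⟩, fun ⟨h, δ, _, h'⟩ => ⟨h, _, h'⟩⟩
  refine DefP.def ?_
  simp only [mem_ofPred_eq, hiff]
  have h1 : DefFn L fun z : ((Fin m → ℝ) × ℝ) × (Fin k → ℝ) =>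
      localSection A σ z.1.1 z.1.2 z.2 := DefFn.localSection hA σ (by fun_prop) (by fun_prop)
        (by fun_prop)
  have h2 : DefFn L fun z : ((Fin m → ℝ) × ℝ) =>
      localSection A σ z.1 z.2 (coordProj k σ z.1) := DefFn.localSection hA σ (by fun_prop)
        (by fun_prop) (by fun_prop)
  have h3 : DefFn L fun z : ((Fin m → ℝ) × ℝ) × (Fin m → ℝ) =>
      localSection A σ z.1.1 z.1.2 (coordProj k σ z.2) := DefFn.localSection hA σ (by fun_prop)
        (by fun_prop) (by fun_prop)
  refine DefP.and (DefP.mem hA ?_) (DefP.ex (DefP.and (DefP.lt ?_ ?_) (DefP.and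
    (DefP.contDiffAt_pi r (F := fun (z : (Fin m → ℝ) × ℝ) x => localSection A σ z.1 z.2 x)
      ?_ ?_) (DefP.and
    (DefP.contDiffAt r (F := fun (z : (Fin m → ℝ) × ℝ) x => f (localSection A σ z.1 z.2 x))
      ?_ ?_) (DefP.and (DefP.eq ?_ ?_) (DefP.and (DefP.eventually_nhds
        (DefP.and (DefP.mem hA ?_) (DefP.eq ?_ ?_)) ?_) (DefP.eventually_nhds
          (DefP.imp (DefP.mem hA ?_) (DefP.eq ?_ ?_)) ?_))))))) <;> fun_prop

variable [hO : Fact (LocallyOMinimal L)]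

theorem DimLt.exists_thin_infinite {A : Set (Fin m → ℝ)} (hA : DimLt L (k + 1) A)
    (σ : Fin k → Fin m) : ∃ T, Thin L T ∧
      ∀ x ∉ T, {a ∈ A | coordProj k σ a = x}.Finite := by
  have hj : ∀ j : Fin m, Thin L (fatFibers (coordProj (k + 1) (Fin.snoc σ j) '' A)) := fun j =>
    ⟨(hA _).isDef.fatFibers, by
      by_contra hne
      have := (hA _).isDef.interior_nonempty_of_fatFibers (nonempty_iff_ne_empty.2 hne)
      simp [(hA _).interior_eq] at this⟩
  refine ⟨_, Thin.iUnion_fin hj, fun x hx => ?_⟩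
  simp only [mem_iUnion, not_exists] at hx
  have h1 : ∀ j : Fin m, {t : ℝ | (Fin.snoc x t : Fin (k + 1) → ℝ) ∈
      coordProj (k + 1) (Fin.snoc σ j) '' A}.Finite := fun j =>
    not_infinite.1 fun h => hx j (mem_fatFibers_of_infinite (hA _).isDef h)
  refine (Set.Finite.pi h1).subset fun a ha j _ => ?_
  exact ⟨a, ha.1, by rw [coordProj_snoc, ha.2]⟩

theorem thin_localSection_not_regAt (r : ℕ) {A : Set (Fin m → ℝ)} (hA : Def L m A)
    (σ : Fin k → Fin m) {f : (Fin m → ℝ) → ℝ} (hf : DefFn L f) (c : Fin m → ℝ) (q : ℝ) :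
    Thin L {x | ∃ b, (b ∈ A ∧ ¬ RegAt r A σ f b) ∧ (dist b c < q ∧ coordProj k σ b = x) ∧
      ∀ b', b' ∈ A → dist b' c < q → coordProj k σ b' = x → b' = b} := by
  have hreg := (hA.regAt (r := r) σ hf).compl
  set D := {x | ∃ b, (b ∈ A ∧ ¬ RegAt r A σ f b) ∧ (dist b c < q ∧ coordProj k σ b = x) ∧
      ∀ b', b' ∈ A → dist b' c < q → coordProj k σ b' = x → b' = b} with hD
  have hDdef : Def L k D := by
    refine DefP.def (DefP.ex (DefP.and (DefP.and (DefP.mem hA ?_) (DefP.mem hreg ?_))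
      (DefP.and (DefP.and (DefP.lt ?_ ?_) (DefP.eq ?_ ?_)) (DefP.all
        (DefP.imp (DefP.mem hA ?_) (DefP.imp (DefP.lt ?_ ?_) (DefP.imp (DefP.eq ?_ ?_)
          (DefP.eq ?_ ?_)))))))) <;> fun_prop
  have hs : DefFn L fun x => localSection A σ c q x :=
    DefFn.localSection hA σ (by fun_prop) (by fun_prop) (by fun_prop)
  have hbad := (thin_not_contDiffAt_pi r hs).union
    (thin_not_contDiffAt r (f := fun x => f (localSection A σ c q x)) (by fun_prop))
  refine ⟨hDdef, ?_⟩
  by_contra hne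
  obtain ⟨x, hx, hx'⟩ : ∃ x ∈ interior D, x ∉ {x | ¬ ContDiffAt ℝ r (localSection A σ c q) x} ∪
      {x | ¬ ContDiffAt ℝ r (fun x => f (localSection A σ c q x)) x} := by
    by_contra! hcon
    exact hne (subset_eq_empty (interior_maximal hcon isOpen_interior) hbad.interior_eq)
  simp only [mem_union, mem_ofPred_eq, not_or, not_not] at hx'
  obtain ⟨b, ⟨hbA, hb⟩, ⟨hbc, rfl⟩, hu⟩ := interior_subset hx
  have hsec := localSection_eq ⟨hbA, hbc, rfl⟩ hu
  refine hb ⟨hbA, _, hx'.1, hx'.2, hsec, ?_, ?_⟩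
  · filter_upwards [mem_interior_iff_mem_nhds.1 hx] with y hy
    obtain ⟨b', ⟨hbA', hb'⟩, ⟨hbc', rfl⟩, hu'⟩ := hy
    rw [localSection_eq ⟨hbA', hbc', rfl⟩ hu']
    exact ⟨hbA', rfl⟩
  · filter_upwards [(continuous_coordProj σ).continuousAt.eventually
      (mem_interior_iff_mem_nhds.1 hx), Metric.isOpen_ball.mem_nhds hbc] with b₁ h1 h2 h3
    obtain ⟨b', ⟨hbA', hb'⟩, ⟨hbc', hp⟩, hu'⟩ := h1
    rw [localSection_eq ⟨hbA', hbc', hp⟩ hu']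
    exact hu' b₁ h3 h2 rfl

theorem exists_rat_dist_lt (b : Fin m → ℝ) {ε : ℝ} (hε : 0 < ε) :
    ∃ c : Fin m → ℚ, dist b (fun i => (c i : ℝ)) < ε := by
  have : ∀ i, ∃ q : ℚ, dist (b i) q < ε := fun i => by
    obtain ⟨q, h1, h2⟩ := exists_rat_btwn (show b i - ε < b i by linarith)
    exact ⟨q, by rw [Real.dist_eq, abs_lt]; constructor <;> linarith⟩
  choose c hc using this
  exact ⟨c, (dist_pi_lt_iff hε).2 hc⟩

/-- If `A` has dimension at most `k`, it is regular over `ℝᵏ` off a thin subset of `ℝᵏ`. -/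
theorem DimLt.thin_not_regAt (r : ℕ) {A : Set (Fin m → ℝ)} (hA : Def L m A)
    (hdim : DimLt L (k + 1) A) (σ : Fin k → Fin m) {f : (Fin m → ℝ) → ℝ} (hf : DefFn L f) :
    Thin L (coordProj k σ '' {a ∈ A | ¬ RegAt r A σ f a}) := by
  obtain ⟨T, hT, hfin⟩ := hdim.exists_thin_infinite σ
  have hreg := (hA.regAt (r := r) σ hf).compl
  have hdef : Def L k (coordProj k σ '' {a ∈ A | ¬ RegAt r A σ f a}) :=
    (hA.inter hreg).image (by fun_prop)
  have h1 : Thin L (coordProj k σ '' {a ∈ A | ¬ RegAt r A σ f a} \ T) := by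
    refine thin_of_subset_iUnion (ι := (Fin m → ℚ) × ℚ)
      (fun q => thin_localSection_not_regAt r hA σ hf (fun i => (q.1 i : ℝ)) q.2)
      (hdef.diff hT.isDef) ?_
    rintro _ ⟨⟨b, ⟨hbA, hb⟩, rfl⟩, hbT⟩
    have hfin' := (hfin _ hbT).subset (sdiff_subset (t := {b}))
    obtain ⟨ε, hε, hball⟩ := Metric.isOpen_iff.1 hfin'.isClosed.isOpen_compl b (by simp)
    obtain ⟨q, hq0, hq⟩ := exists_rat_btwn (half_pos hε)
    obtain ⟨c, hc⟩ := exists_rat_dist_lt b hq0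
    refine mem_iUnion.2 ⟨(c, q), b, ⟨hbA, hb⟩, ⟨hc, rfl⟩, fun b' hb' hd hp => ?_⟩
    by_contra hne
    refine hball (show dist b' b < ε from ?_) ⟨⟨hb', hp⟩, hne⟩
    have := dist_triangle_right b' b (fun i => (c i : ℝ))
    simp only at hd
    linarith
  exact (h1.union hT).mono hdef fun x hx => by
    by_cases h : x ∈ T
    exacts [Or.inr h, Or.inl ⟨hx, h⟩]

end RegularPoints

section Cutoff

theorem hasDerivAt_max_zero_pow (n : ℕ) (t : ℝ) :
    HasDerivAt (fun t : ℝ => max 0 t ^ (n + 2)) ((n + 2) * max 0 t ^ (n + 1)) t := by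
  rcases lt_trichotomy t 0 with ht | rfl | ht
  · rw [max_eq_left ht.le]
    have h0 : (fun t : ℝ => max 0 t ^ (n + 2)) =ᶠ[𝓝 t] fun _ => 0 := by
      filter_upwards [Iio_mem_nhds ht] with s hs
      rw [max_eq_left (le_of_lt hs), zero_pow (by lia)]
    simpa using (hasDerivAt_const t (0 : ℝ)).congr_of_eventuallyEq h0
  · rw [hasDerivAt_iff_isLittleO_nhds_zero]
    simp only [zero_add, max_self, ne_eq, Nat.add_eq_zero_iff, OfNat.ofNat_ne_zero, and_false,
      not_false_eq_true, zero_pow, one_ne_zero, mul_zero, smul_zero, sub_zero]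
    have h1 : (fun h : ℝ => h ^ (n + 2)) =o[𝓝 0] fun h => h := by
      simpa using Asymptotics.isLittleO_pow_id (𝕜 := ℝ) (n := n + 2) (by lia)
    refine Asymptotics.IsBigO.trans_isLittleO (Asymptotics.IsBigO.of_bound 1
      (Filter.Eventually.of_forall fun h => ?_)) h1
    rw [one_mul, norm_pow, norm_pow]
    gcongr
    rcases le_total h 0 with h' | h'
    · simp [max_eq_left h']
    · simp [max_eq_right h']
  · rw [max_eq_right ht.le]
    have h0 : (fun t : ℝ => max 0 t ^ (n + 2)) =ᶠ[𝓝 t] fun t => t ^ (n + 2) := by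
      filter_upwards [Ioi_mem_nhds ht] with s hs
      rw [max_eq_right (le_of_lt hs)]
    have := (hasDerivAt_pow (n + 2) t).congr_of_eventuallyEq h0
    simpa using this

theorem contDiff_max_zero_pow (r : ℕ) : ContDiff ℝ r fun t : ℝ => max 0 t ^ (r + 1) := by
  induction r with
  | zero => exact contDiff_zero.2 (by fun_prop)
  | succ r ih =>
    rw [Nat.cast_add, Nat.cast_one, contDiff_succ_iff_deriv]
    refine ⟨fun t => (hasDerivAt_max_zero_pow r t).differentiableAt, by simp, ?_⟩
    rw [show deriv (fun t : ℝ => max 0 t ^ (r + 1 + 1)) =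
      fun t : ℝ => ((r : ℝ) + 2) * max 0 t ^ (r + 1) from
      funext fun t => (hasDerivAt_max_zero_pow r t).deriv]
    exact contDiff_const.mul ih

/-- A `C^r` function that is `1` on `(-∞, 1/4]` and `0` on `[1/2, ∞)`. -/
noncomputable def cutoff (r : ℕ) (t : ℝ) : ℝ :=
  max 0 (1 / 2 - t) ^ (r + 1) / (max 0 (1 / 2 - t) ^ (r + 1) + max 0 (t - 1 / 4) ^ (r + 1))

theorem cutoff_denom_pos (r : ℕ) (t : ℝ) :
    0 < max 0 (1 / 2 - t) ^ (r + 1) + max 0 (t - 1 / 4) ^ (r + 1) := by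
  rcases lt_or_ge t (1 / 2) with h | h
  · have : 0 < max 0 (1 / 2 - t) := lt_max_of_lt_right (by linarith)
    positivity
  · have : 0 < max 0 (t - 1 / 4) := lt_max_of_lt_right (by linarith)
    positivity

theorem contDiff_cutoff (r : ℕ) : ContDiff ℝ r (cutoff r) := by
  unfold cutoff
  have h1 := (contDiff_max_zero_pow r).comp (contDiff_const.sub contDiff_id :
    ContDiff ℝ r fun t : ℝ => 1 / 2 - t)
  have h2 := (contDiff_max_zero_pow r).comp (contDiff_id.sub contDiff_const :
    ContDiff ℝ r fun t : ℝ => t - 1 / 4)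
  exact h1.div (h1.add h2) fun t => (cutoff_denom_pos r t).ne'

theorem cutoff_eq_one (r : ℕ) {t : ℝ} (h : t ≤ 1 / 4) : cutoff r t = 1 := by
  have h1 := cutoff_denom_pos r t
  rw [cutoff]
  rw [max_eq_left (show t - 1 / 4 ≤ 0 by linarith), zero_pow (by lia), add_zero] at h1 ⊢
  exact div_self h1.ne'

theorem cutoff_eq_zero (r : ℕ) {t : ℝ} (h : 1 / 2 ≤ t) : cutoff r t = 0 := by
  rw [cutoff, max_eq_left (show 1 / 2 - t ≤ 0 by linarith), zero_pow (by lia), zero_div]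

theorem cutoff_nonneg (r : ℕ) (t : ℝ) : 0 ≤ cutoff r t := by
  unfold cutoff
  positivity

theorem cutoff_le_one (r : ℕ) (t : ℝ) : cutoff r t ≤ 1 := by
  refine div_le_one_of_le₀ ?_ (cutoff_denom_pos r t).le
  have : 0 ≤ max 0 (t - 1 / 4) ^ (r + 1) := by positivity
  linarith

variable {L} {α : Type} [Coord α] [hF : Fact (ExpandsOrderedField L)]

@[fun_prop]
theorem DefFn.cutoff (r : ℕ) {f : α → ℝ} (hf : DefFn L f) : DefFn L fun x => cutoff r (f x) := by
  unfold Paper.cutoff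
  fun_prop

end Cutoff

section DistTo

variable {k : ℕ}

/-- The distance to `Z`, truncated at `1`. -/
noncomputable def distTo (Z : Set (Fin k → ℝ)) (x : Fin k → ℝ) : ℝ :=
  sSup {t | t ≤ 1 ∧ ∀ c, c ∈ Z → t ≤ dist x c}

theorem zero_mem_distTo (Z : Set (Fin k → ℝ)) (x : Fin k → ℝ) :
    (0 : ℝ) ∈ {t | t ≤ 1 ∧ ∀ c, c ∈ Z → t ≤ dist x c} :=
  ⟨zero_le_one, fun _ _ => dist_nonneg⟩

theorem le_distTo {Z : Set (Fin k → ℝ)} {x : Fin k → ℝ} {t : ℝ} (h1 : t ≤ 1)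
    (h : ∀ c ∈ Z, t ≤ dist x c) : t ≤ distTo Z x :=
  le_csSup ⟨1, fun _ h => h.1⟩ ⟨h1, h⟩

theorem distTo_nonneg (Z : Set (Fin k → ℝ)) (x : Fin k → ℝ) : 0 ≤ distTo Z x :=
  le_distTo zero_le_one fun _ _ => dist_nonneg

theorem distTo_le_dist {Z : Set (Fin k → ℝ)} (x : Fin k → ℝ) {c : Fin k → ℝ} (hc : c ∈ Z) :
    distTo Z x ≤ dist x c :=
  csSup_le ⟨0, zero_mem_distTo Z x⟩ fun _ h => h.2 c hc

theorem distTo_eq_zero {Z : Set (Fin k → ℝ)} {x : Fin k → ℝ} (hx : x ∈ Z) : distTo Z x = 0 :=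
  le_antisymm (by simpa using distTo_le_dist x hx) (distTo_nonneg Z x)

theorem distTo_pos {Z : Set (Fin k → ℝ)} (hZ : IsClosed Z) {x : Fin k → ℝ} (hx : x ∉ Z) :
    0 < distTo Z x := by
  obtain ⟨ε, hε, h⟩ := Metric.isOpen_iff.1 hZ.isOpen_compl x hx
  refine lt_of_lt_of_le (lt_min one_pos hε) (le_distTo (min_le_left _ _) fun c hc => ?_)
  by_contra! hlt
  exact h (show dist c x < ε by rw [dist_comm]; exact hlt.trans_le (min_le_right _ _)) hc

theorem distTo_le_add (Z : Set (Fin k → ℝ)) (x y : Fin k → ℝ) :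
    distTo Z x ≤ distTo Z y + dist x y := by
  refine csSup_le ⟨0, zero_mem_distTo Z x⟩ fun t ht => ?_
  rw [← sub_le_iff_le_add]
  refine le_distTo (by linarith [ht.1, dist_nonneg (x := x) (y := y)]) fun c hc => ?_
  linarith [ht.2 c hc, dist_triangle x y c]

theorem continuous_distTo (Z : Set (Fin k → ℝ)) : Continuous (distTo Z) :=
  (LipschitzWith.of_le_add (distTo_le_add Z)).continuous

variable {L} {α : Type} [Coord α] [hF : Fact (ExpandsOrderedField L)]

theorem DefFn.distTo {Z : Set (Fin k → ℝ)} (hZ : Def L k Z) {f : α → Fin k → ℝ}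
    (hf : DefFn L f) : DefFn L fun x => distTo Z (f x) := by
  refine DefFn.sSup (p := fun x t => t ≤ 1 ∧ ∀ c, c ∈ Z → t ≤ Dist.dist (f x) c) ?_
  refine DefP.and (DefP.le ?_ ?_) (DefP.all (DefP.imp (DefP.mem hZ ?_) (DefP.le ?_ ?_))) <;>
    fun_prop

end DistTo

section Tubes

variable {m k r : ℕ} {A S : Set (Fin m → ℝ)} {σ : Fin k → Fin m} {f : (Fin m → ℝ) → ℝ}

theorem RegAt.regAt_setOf {a : Fin m → ℝ} (h : RegAt r A σ f a) :
    RegAt r {a | RegAt r A σ f a} σ f a := by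
  have hev := h.eventually
  obtain ⟨s, h1, h2, h3, h4, h5⟩ := id h.2
  refine ⟨h, s, h1, h2, h3, ?_, h5.mono fun b hb hbA => hb hbA.1⟩
  have hs : Filter.Tendsto s (𝓝 (coordProj k σ a)) (𝓝 a) := by
    have := h1.continuousAt.tendsto
    rwa [h3] at this
  filter_upwards [h4, hs.eventually hev] with x hx hx'
  exact ⟨hx' hx.1, hx.2⟩

open Classical in
/-- A point related to `u`, if there is one. -/
noncomputable def select (R : (Fin m → ℝ) → (Fin m → ℝ) → Prop) (u : Fin m → ℝ) : Fin m → ℝ :=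
  if h : ∃ b, R u b then h.choose else 0

variable {R : (Fin m → ℝ) → (Fin m → ℝ) → Prop}

theorem select_spec {u : Fin m → ℝ} (h : ∃ b, R u b) : R u (select R u) := by
  rw [select, dif_pos h]
  exact h.choose_spec

theorem select_eq (huniq : ∀ u b b', R u b → R u b' → b = b') {u b : Fin m → ℝ} (h : R u b) :
    select R u = b :=
  huniq _ _ _ (select_spec ⟨b, h⟩) h

theorem DefFn.select {L : FirstOrder.Language} [L.Structure ℝ]
    (hR : DefP L fun z : (Fin m → ℝ) × (Fin m → ℝ) => R z.1 z.2)
    (huniq : ∀ u b b', R u b → R u b' → b = b') : DefFn L (select R) :=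
  DefFn.choose (b := 0) hR (fun _ h => select_spec h)
    (fun u h => by rw [Paper.select, dif_neg h]) huniq

/-- A relation between points `u` and points of `S` in the same fibre that is open on such pairs
is given near each related pair by a local section. -/
theorem exists_section_of_open (hreg : ∀ a ∈ S, RegAt r S σ f a)
    (hR : ∀ u b, R u b → b ∈ S ∧ coordProj k σ b = coordProj k σ u)
    (hopen : ∀ u b, R u b → ∀ᶠ z in 𝓝 (u, b), z.2 ∈ S → coordProj k σ z.2 = coordProj k σ z.1 →
      R z.1 z.2) {u b : Fin m → ℝ} (h : R u b) :
    ∃ s : (Fin k → ℝ) → (Fin m → ℝ), ContDiffAt ℝ r s (coordProj k σ u) ∧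
      ContDiffAt ℝ r (fun x => f (s x)) (coordProj k σ u) ∧ s (coordProj k σ u) = b ∧
      ∀ᶠ v in 𝓝 u, R v (s (coordProj k σ v)) := by
  obtain ⟨hb, hbu⟩ := hR u b h
  obtain ⟨-, s, h1, h2, h3, h4, -⟩ := hreg b hb
  rw [hbu] at h1 h2 h3 h4
  have hπ := (continuous_coordProj σ).continuousAt (x := u)
  refine ⟨s, h1, h2, h3, ?_⟩
  have ht : Filter.Tendsto (fun v => (v, s (coordProj k σ v))) (𝓝 u) (𝓝 (u, b)) := by
    refine Filter.tendsto_id.prodMk_nhds ?_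
    have := h1.continuousAt.tendsto.comp hπ.tendsto
    rwa [h3] at this
  filter_upwards [ht.eventually (hopen u b h), hπ.eventually h4] with v h5 h6
  exact h5 h6.1 h6.2

theorem isOpen_of_open (hreg : ∀ a ∈ S, RegAt r S σ f a)
    (hR : ∀ u b, R u b → b ∈ S ∧ coordProj k σ b = coordProj k σ u)
    (hopen : ∀ u b, R u b → ∀ᶠ z in 𝓝 (u, b), z.2 ∈ S → coordProj k σ z.2 = coordProj k σ z.1 →
      R z.1 z.2) : IsOpen {u | ∃ b, R u b} := by
  rw [isOpen_iff_mem_nhds]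
  rintro u ⟨b, h⟩
  obtain ⟨s, -, -, -, h⟩ := exists_section_of_open hreg hR hopen h
  filter_upwards [h] with v hv using ⟨_, hv⟩

end Tubes

section Smoothing

variable {m k r : ℕ} {Ω A Z : Set (Fin m → ℝ)} {σ : Fin k → Fin m} {f h : (Fin m → ℝ) → ℝ}

/-- The point `u` of `Ω` is close enough to the regular point `a` of `A`. -/
structure Near (r : ℕ) (Ω A : Set (Fin m → ℝ)) (σ : Fin k → Fin m) (f h : (Fin m → ℝ) → ℝ)
    (a u : Fin m → ℝ) : Prop where
  mem : u ∈ Ω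
  regAt : u ∈ A → RegAt r A σ f u
  eq_of_coordProj : u ∈ A → coordProj k σ u = coordProj k σ a → u = a
  abs_sub_lt : |f u - f a| < h u

theorem RegAt.eventually_near {a : Fin m → ℝ} (ha : RegAt r A σ f a) (hΩ : IsOpen Ω) (haΩ : a ∈ Ω)
    (hf : ContinuousAt f a) (hh : ContinuousAt h a) (hpos : 0 < h a) :
    ∀ᶠ u in 𝓝 a, Near r Ω A σ f h a u := by
  obtain ⟨s, -, -, h3, -, h5⟩ := id ha.2
  have h6 : ContinuousAt (fun u => |f u - f a|) a := (hf.sub continuousAt_const).abs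
  filter_upwards [hΩ.mem_nhds haΩ, ha.eventually, h5,
    h6.eventually_lt hh (by simpa using hpos)] with u h1 h2 h7 h8
  exact ⟨h1, h2, fun hu hπ => by rw [h7 hu, hπ, h3], h8⟩

/-- The radius, at most `1`, of the balls around points of a fibre consisting of near points. -/
noncomputable def nearRadius (r : ℕ) (Ω A : Set (Fin m → ℝ)) (σ : Fin k → Fin m)
    (f h : (Fin m → ℝ) → ℝ) (x : Fin k → ℝ) : ℝ :=
  sSup {t | t ≤ 1 ∧ ∀ a, RegAt r A σ f a → coordProj k σ a = x → ∀ u, dist u a < t →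
    Near r Ω A σ f h a u}

theorem near_of_dist_lt {a u : Fin m → ℝ} (ha : RegAt r A σ f a)
    (h1 : dist u a < nearRadius r Ω A σ f h (coordProj k σ a)) : Near r Ω A σ f h a u := by
  have hne : {t | t ≤ 1 ∧ ∀ b, RegAt r A σ f b → coordProj k σ b = coordProj k σ a →
      ∀ u, dist u b < t → Near r Ω A σ f h b u}.Nonempty :=
    ⟨0, zero_le_one, fun a _ _ u hu => absurd hu (not_lt.2 dist_nonneg)⟩
  obtain ⟨t, ht, h2⟩ := exists_lt_of_lt_csSup hne h1
  exact ht.2 a ha rfl u h2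

theorem nearRadius_pos (hΩ : IsOpen Ω) (hAΩ : A ⊆ Ω) (hf : ∀ x ∈ Ω, ContinuousAt f x)
    (hh : ∀ x ∈ Ω, ContinuousAt h x) (hpos : ∀ x ∈ Ω, 0 < h x) {x : Fin k → ℝ}
    (hfin : {a ∈ A | coordProj k σ a = x}.Finite) : 0 < nearRadius r Ω A σ f h x := by
  have h1 : ∀ a ∈ {a ∈ A | coordProj k σ a = x}, ∀ᶠ t in 𝓝[>] (0 : ℝ), RegAt r A σ f a →
      ∀ u, dist u a < t → Near r Ω A σ f h a u := by
    rintro a ⟨ha, -⟩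
    by_cases hr : RegAt r A σ f a
    · obtain ⟨ε, hε, h2⟩ := Metric.eventually_nhds_iff.1
        (hr.eventually_near hΩ (hAΩ ha) (hf a (hAΩ ha)) (hh a (hAΩ ha)) (hpos a (hAΩ ha)))
      filter_upwards [Ioo_mem_nhdsGT hε] with t ht _ u hu using h2 (hu.trans ht.2)
    · exact Filter.Eventually.of_forall fun t h => absurd h hr
  have h2 := (Filter.eventually_all_finite hfin).2 h1
  obtain ⟨t, ht, ht', h3⟩ := (h2.and (Ioo_mem_nhdsGT one_pos)).exists
  exact lt_of_lt_of_le ht' (le_csSup ⟨1, fun _ h => h.1⟩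
    ⟨h3.le, fun a ha hx u hu => ht a ⟨ha.1, hx⟩ ha u hu⟩)

/-- Two points `u`, `b` of the same fibre, with `b` a regular point of `A`, are at a distance
smaller than the radius `g`. -/
structure TubeRel (r : ℕ) (A : Set (Fin m → ℝ)) (σ : Fin k → Fin m) (f : (Fin m → ℝ) → ℝ)
    (Z : Set (Fin k → ℝ)) (g : (Fin k → ℝ) → ℝ) (u b : Fin m → ℝ) : Prop where
  notMem : coordProj k σ u ∉ Z
  regAt : RegAt r A σ f b
  coordProj_eq : coordProj k σ b = coordProj k σ u
  lt : ∑ j, (u j - b j) ^ 2 < g (coordProj k σ u) ^ 2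

/-- A neighbourhood of most regular points of `A`, as a union of tubes around the graphs of
`C^r` maps. -/
structure TubeData (r : ℕ) (Ω A : Set (Fin m → ℝ)) (σ : Fin k → Fin m) (f h : (Fin m → ℝ) → ℝ)
    (Z : Set (Fin k → ℝ)) (g : (Fin k → ℝ) → ℝ) : Prop where
  isOpen_diff : IsOpen (Ω \ A)
  continuousAt : ∀ x ∈ Ω, ContinuousAt f x
  contDiffAt : ∀ x ∈ Ω \ A, ContDiffAt ℝ r f x
  pos : ∀ x ∈ Ω, 0 < h x
  isClosed : IsClosed Z
  radius_pos : ∀ x ∉ Z, 0 < g x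
  contDiffAt_radius : ∀ x ∉ Z, ContDiffAt ℝ r g x
  radius_le : ∀ x ∉ Z, ∀ c ∈ Z, g x ≤ 2 * dist x c
  near : ∀ a, RegAt r A σ f a → coordProj k σ a ∉ Z → ∀ u, dist u a < 2 * g (coordProj k σ a) →
    Near r Ω A σ f h a u

variable {Z : Set (Fin k → ℝ)} {g : (Fin k → ℝ) → ℝ} {u b : Fin m → ℝ}

theorem TubeRel.dist_lt (hR : TubeRel r A σ f Z g u b) (hg : 0 < g (coordProj k σ u)) :
    dist u b < g (coordProj k σ u) := by
  rw [dist_pi_lt_iff hg]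
  intro j
  rw [Real.dist_eq]
  refine abs_lt_of_sq_lt_sq (lt_of_le_of_lt ?_ hR.lt) hg.le
  exact Finset.single_le_sum (f := fun j => (u j - b j) ^ 2) (fun _ _ => sq_nonneg _)
    (Finset.mem_univ j)

namespace TubeData

theorem dist_lt (hT : TubeData r Ω A σ f h Z g) (hR : TubeRel r A σ f Z g u b) :
    dist u b < g (coordProj k σ u) :=
  hR.dist_lt (hT.radius_pos _ hR.notMem)

theorem near_of_tubeRel (hT : TubeData r Ω A σ f h Z g) (hR : TubeRel r A σ f Z g u b) :
    Near r Ω A σ f h b u := by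
  have h1 := hT.dist_lt hR
  refine hT.near b hR.regAt (hR.coordProj_eq ▸ hR.notMem) u ?_
  rw [hR.coordProj_eq]
  linarith [hT.radius_pos _ hR.notMem]

theorem unique (hT : TubeData r Ω A σ f h Z g) (u b b' : Fin m → ℝ) (hR : TubeRel r A σ f Z g u b)
    (hR' : TubeRel r A σ f Z g u b') : b = b' := by
  have h1 := hT.dist_lt hR
  have h2 := hT.dist_lt hR'
  refine (hT.near b' hR'.regAt (hR'.coordProj_eq ▸ hR'.notMem) b ?_).eq_of_coordProj hR.regAt.1
    (hR.coordProj_eq.trans hR'.coordProj_eq.symm)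
  rw [hR'.coordProj_eq]
  linarith [dist_triangle_left b b' u]

theorem eventually_tubeRel (hT : TubeData r Ω A σ f h Z g) (u b : Fin m → ℝ)
    (hR : TubeRel r A σ f Z g u b) :
    ∀ᶠ z in 𝓝 (u, b), z.2 ∈ {a | RegAt r A σ f a} → coordProj k σ z.2 = coordProj k σ z.1 →
      TubeRel r A σ f Z g z.1 z.2 := by
  have hπ : ContinuousAt (fun z : (Fin m → ℝ) × (Fin m → ℝ) => coordProj k σ z.1) (u, b) :=
    ((continuous_coordProj σ).comp continuous_fst).continuousAt
  have h1 : ContinuousAt (fun z : (Fin m → ℝ) × (Fin m → ℝ) => g (coordProj k σ z.1) ^ 2) (u, b) :=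
    ContinuousAt.pow (ContinuousAt.comp (f := fun z : (Fin m → ℝ) × (Fin m → ℝ) =>
      coordProj k σ z.1) (hT.contDiffAt_radius _ hR.notMem).continuousAt hπ) 2
  have h2 : ContinuousAt (fun z : (Fin m → ℝ) × (Fin m → ℝ) => ∑ j, (z.1 j - z.2 j) ^ 2) (u, b) :=
    Continuous.continuousAt (by fun_prop)
  filter_upwards [hπ.eventually (hT.isClosed.isOpen_compl.mem_nhds hR.notMem),
    h2.eventually_lt h1 hR.lt] with z h3 h4 h5 h6
  exact ⟨h3, h5, h6, h4⟩

theorem exists_section (hT : TubeData r Ω A σ f h Z g) (hR : TubeRel r A σ f Z g u b) :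
    ∃ s : (Fin k → ℝ) → (Fin m → ℝ), ContDiffAt ℝ r s (coordProj k σ u) ∧
      ContDiffAt ℝ r (fun x => f (s x)) (coordProj k σ u) ∧ s (coordProj k σ u) = b ∧
      ∀ᶠ v in 𝓝 u, TubeRel r A σ f Z g v (s (coordProj k σ v)) :=
  exists_section_of_open (S := {a | RegAt r A σ f a}) (fun _ ha => ha.regAt_setOf)
    (fun _ _ h => ⟨h.regAt, h.coordProj_eq⟩) hT.eventually_tubeRel hR

theorem isOpen_tube (hT : TubeData r Ω A σ f h Z g) :
    IsOpen {u | ∃ b, TubeRel r A σ f Z g u b} :=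
  isOpen_of_open (S := {a | RegAt r A σ f a}) (fun _ ha => ha.regAt_setOf)
    (fun _ _ h => ⟨h.regAt, h.coordProj_eq⟩) hT.eventually_tubeRel

/-- Away from the exceptional set, a point outside of the tube is not close to the core of the
tube. -/
theorem eventually_le (hT : TubeData r Ω A σ f h Z g) {u₀ : Fin m → ℝ} (hu₀ : u₀ ∈ Ω)
    (hN : ¬ ∃ b, TubeRel r A σ f Z g u₀ b) (hZ : coordProj k σ u₀ ∈ Z → u₀ ∉ A) :
    ∀ᶠ u in 𝓝 u₀, ∀ b, TubeRel r A σ f Z g u b →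
      1 / 2 ≤ (∑ j, (u j - b j) ^ 2) / g (coordProj k σ u) ^ 2 := by
  by_cases hZ' : coordProj k σ u₀ ∈ Z
  · obtain ⟨ε, hε, h1⟩ := Metric.isOpen_iff.1 hT.isOpen_diff u₀ ⟨hu₀, hZ hZ'⟩
    filter_upwards [Metric.ball_mem_nhds u₀ (by positivity : 0 < ε / 3)] with u hu b hR
    rw [Metric.mem_ball] at hu
    have h2 := hT.dist_lt hR
    have h3 := hT.radius_le _ hR.notMem _ hZ'
    have h4 := dist_coordProj_le σ u u₀
    have h5 : b ∈ Metric.ball u₀ ε := by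
      rw [Metric.mem_ball]
      linarith [dist_triangle_left b u₀ u]
    exact absurd hR.regAt.1 (h1 h5).2
  by_contra hfr
  rw [Filter.not_eventually] at hfr
  obtain ⟨F, hF1, hF2⟩ : ∃ F : Ultrafilter (Fin m → ℝ), (F : Filter (Fin m → ℝ)) ≤ 𝓝 u₀ ∧
      ∀ᶠ u in (F : Filter (Fin m → ℝ)), ¬ ∀ b, TubeRel r A σ f Z g u b →
        1 / 2 ≤ (∑ j, (u j - b j) ^ 2) / g (coordProj k σ u) ^ 2 := by
    have : (𝓝 u₀ ⊓ Filter.principal {u | ¬ ∀ b, TubeRel r A σ f Z g u b →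
        1 / 2 ≤ (∑ j, (u j - b j) ^ 2) / g (coordProj k σ u) ^ 2}).NeBot :=
      Filter.frequently_mem_iff_neBot.1 hfr
    obtain ⟨F, hF⟩ := Ultrafilter.exists_le (𝓝 u₀ ⊓ Filter.principal {u | ¬ ∀ b,
      TubeRel r A σ f Z g u b → 1 / 2 ≤ (∑ j, (u j - b j) ^ 2) / g (coordProj k σ u) ^ 2})
    exact ⟨F, hF.trans inf_le_left, (hF.trans inf_le_right) (Filter.mem_principal_self _)⟩
  obtain ⟨ρ, hρ⟩ : ∃ ρ, ρ = select (TubeRel r A σ f Z g) := ⟨_, rfl⟩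
  have hF3 : ∀ᶠ u in (F : Filter (Fin m → ℝ)), TubeRel r A σ f Z g u (ρ u) ∧
      ∑ j, (u j - ρ u j) ^ 2 ≤ 1 / 2 * g (coordProj k σ u) ^ 2 := by
    filter_upwards [hF2] with u hu
    push Not at hu
    obtain ⟨b, hR, hb⟩ := hu
    have h1 : ρ u = b := hρ ▸ select_eq hT.unique hR
    rw [h1]
    refine ⟨hR, ?_⟩
    rw [div_lt_iff₀ (pow_pos (hT.radius_pos _ hR.notMem) 2)] at hb
    exact hb.le
  have hg0 := hT.radius_pos _ hZ'
  have hπ : Filter.Tendsto (coordProj k σ) F (𝓝 (coordProj k σ u₀)) :=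
    (continuous_coordProj σ).continuousAt.tendsto.mono_left hF1
  have hgt : Filter.Tendsto (fun u => g (coordProj k σ u)) F (𝓝 (g (coordProj k σ u₀))) :=
    (hT.contDiffAt_radius _ hZ').continuousAt.tendsto.comp hπ
  have hbdd : ∀ᶠ u in (F : Filter (Fin m → ℝ)),
      ρ u ∈ Metric.closedBall u₀ (1 + 2 * g (coordProj k σ u₀)) := by
    filter_upwards [hF3, hgt.eventually_lt_const (show _ < 2 * g (coordProj k σ u₀) by linarith),
      hF1 (Metric.ball_mem_nhds u₀ one_pos)] with u h1 h2 h3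
    rw [Metric.mem_ball] at h3
    rw [Metric.mem_closedBall]
    linarith [hT.dist_lt h1.1, dist_triangle_left (ρ u) u₀ u]
  obtain ⟨b₀, -, hb₀⟩ :=
    (isCompact_closedBall u₀ (1 + 2 * g (coordProj k σ u₀))).ultrafilter_le_nhds
      (F.map ρ) (Filter.le_principal_iff.2 hbdd)
  have hρt : Filter.Tendsto ρ F (𝓝 b₀) := hb₀
  have hπb : coordProj k σ b₀ = coordProj k σ u₀ := by
    have h1 : Filter.Tendsto (fun u => coordProj k σ (ρ u)) F (𝓝 (coordProj k σ b₀)) :=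
      ((continuous_coordProj σ).tendsto b₀).comp hρt
    have h2 : Filter.Tendsto (fun u => coordProj k σ (ρ u)) F (𝓝 (coordProj k σ u₀)) :=
      hπ.congr' (hF3.mono fun u hu => hu.1.coordProj_eq.symm)
    exact tendsto_nhds_unique h1 h2
  have hid : Filter.Tendsto id (F : Filter (Fin m → ℝ)) (𝓝 u₀) := hF1
  have hsq : Filter.Tendsto (fun u => ∑ j, (u j - ρ u j) ^ 2) F (𝓝 (∑ j, (u₀ j - b₀ j) ^ 2)) :=
    tendsto_finsetSum _ fun j _ =>
      ((tendsto_pi_nhds.1 hid j).sub (tendsto_pi_nhds.1 hρt j)).pow 2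
  have hle : ∑ j, (u₀ j - b₀ j) ^ 2 ≤ 1 / 2 * g (coordProj k σ u₀) ^ 2 :=
    le_of_tendsto_of_tendsto hsq ((hgt.pow 2).const_mul _) (hF3.mono fun u hu => hu.2)
  obtain ⟨u, ⟨hRu, -⟩, hu2, hu3⟩ := (hF3.and ((hgt.eventually_const_lt
    (show g (coordProj k σ u₀) / 2 < _ by linarith)).and
    (hρt (Metric.ball_mem_nhds b₀ hg0)))).exists
  have hnear : Near r Ω A σ f h (ρ u) b₀ := by
    refine hT.near _ hRu.regAt (hRu.coordProj_eq ▸ hRu.notMem) _ ?_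
    rw [hRu.coordProj_eq]
    have hu3' : dist (ρ u) b₀ < g (coordProj k σ u₀) := hu3
    rw [dist_comm]
    linarith
  have hbA : b₀ ∈ A := by
    by_contra hbA
    obtain ⟨v, hv1, hv2⟩ := (hF3.and (hρt (hT.isOpen_diff.mem_nhds ⟨hnear.mem, hbA⟩))).exists
    exact hv2.2 hv1.1.regAt.1
  refine hN ⟨b₀, hZ', hnear.regAt hbA, hπb, ?_⟩
  nlinarith [hle, pow_pos hg0 2]

end TubeData

open Classical in
/-- The function that is constant on the fibres of the tube near its core, and is `f` off the
tube. -/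
noncomputable def tubeSmoothing (r : ℕ) (A : Set (Fin m → ℝ)) (σ : Fin k → Fin m)
    (f : (Fin m → ℝ) → ℝ) (Z : Set (Fin k → ℝ)) (g : (Fin k → ℝ) → ℝ) (u : Fin m → ℝ) : ℝ :=
  if ∃ b, TubeRel r A σ f Z g u b then
    f u + cutoff r ((∑ j, (u j - select (TubeRel r A σ f Z g) u j) ^ 2) /
      g (coordProj k σ u) ^ 2) * (f (select (TubeRel r A σ f Z g) u) - f u)
  else f u

theorem tubeSmoothing_of_tubeRel (hT : TubeData r Ω A σ f h Z g) (hR : TubeRel r A σ f Z g u b) :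
    tubeSmoothing r A σ f Z g u = f u + cutoff r ((∑ j, (u j - b j) ^ 2) /
      g (coordProj k σ u) ^ 2) * (f b - f u) := by
  rw [tubeSmoothing, if_pos ⟨b, hR⟩, select_eq hT.unique hR]

theorem tubeSmoothing_of_not (hN : ¬ ∃ b, TubeRel r A σ f Z g u b) :
    tubeSmoothing r A σ f Z g u = f u := if_neg hN

theorem abs_tubeSmoothing_sub_le_of_tubeRel (hT : TubeData r Ω A σ f h Z g)
    (hR : TubeRel r A σ f Z g u b) : |tubeSmoothing r A σ f Z g u - f u| ≤ |f b - f u| := by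
  rw [tubeSmoothing_of_tubeRel hT hR, add_sub_cancel_left, abs_mul,
    abs_of_nonneg (cutoff_nonneg _ _)]
  exact mul_le_of_le_one_left (abs_nonneg _) (cutoff_le_one _ _)

theorem abs_tubeSmoothing_sub_le (hT : TubeData r Ω A σ f h Z g) (hu : u ∈ Ω) :
    |tubeSmoothing r A σ f Z g u - f u| ≤ h u := by
  by_cases hN : ∃ b, TubeRel r A σ f Z g u b
  · obtain ⟨b, hR⟩ := hN
    refine (abs_tubeSmoothing_sub_le_of_tubeRel hT hR).trans ?_
    rw [abs_sub_comm]
    exact (hT.near_of_tubeRel hR).abs_sub_lt.le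
  · rw [tubeSmoothing_of_not hN, sub_self, abs_zero]
    exact (hT.pos u hu).le

theorem tubeSmoothing_eventuallyEq (hT : TubeData r Ω A σ f h Z g) {u₀ : Fin m → ℝ}
    (hu₀ : u₀ ∈ Ω) (hN : ¬ ∃ b, TubeRel r A σ f Z g u₀ b)
    (hZ : coordProj k σ u₀ ∈ Z → u₀ ∉ A) : tubeSmoothing r A σ f Z g =ᶠ[𝓝 u₀] f := by
  filter_upwards [hT.eventually_le hu₀ hN hZ] with u hu
  by_cases hN : ∃ b, TubeRel r A σ f Z g u b
  · obtain ⟨b, hR⟩ := hN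
    rw [tubeSmoothing_of_tubeRel hT hR, cutoff_eq_zero r (hu b hR), zero_mul, add_zero]
  · exact tubeSmoothing_of_not hN

theorem contDiffAt_tubeSmoothing_of_tubeRel (hT : TubeData r Ω A σ f h Z g)
    (hR : TubeRel r A σ f Z g u b) : ContDiffAt ℝ r (tubeSmoothing r A σ f Z g) u := by
  obtain ⟨s, h1, h2, h3, h4⟩ := hT.exists_section hR
  have hπ : ContDiffAt ℝ r (coordProj k σ) u := (contDiff_coordProj σ).contDiffAt
  have hs : ContDiffAt ℝ r (fun v => s (coordProj k σ v)) u := h1.comp u hπ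
  have hfs : ContDiffAt ℝ r (fun v => f (s (coordProj k σ v))) u := h2.comp u hπ
  have hg : ContDiffAt ℝ r (fun v => g (coordProj k σ v)) u :=
    (hT.contDiffAt_radius _ hR.notMem).comp u hπ
  have hq : ContDiffAt ℝ r (fun v => (∑ j, (v j - s (coordProj k σ v) j) ^ 2) /
      g (coordProj k σ v) ^ 2) u := by
    refine ContDiffAt.div (ContDiffAt.sum fun j _ => ?_) (hg.pow 2)
      (pow_pos (hT.radius_pos _ hR.notMem) 2).ne'
    exact (((contDiff_apply ℝ ℝ j).contDiffAt).sub (contDiffAt_pi.1 hs j)).pow 2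
  by_cases hA : u ∈ A
  · have hub : u = b := by
      have := hT.near_of_tubeRel hR
      exact this.eq_of_coordProj hA hR.coordProj_eq.symm
    refine hfs.congr_of_eventuallyEq ?_
    have h5 := hq.continuousAt.eventually_lt_const
      (show _ < (1 / 4 : ℝ) by simp [h3.trans hub.symm])
    filter_upwards [h4, h5] with v hv hv'
    rw [tubeSmoothing_of_tubeRel hT hv, cutoff_eq_one r hv'.le]
    ring
  · have hf := hT.contDiffAt u ⟨(hT.near_of_tubeRel hR).mem, hA⟩
    refine (hf.add (((contDiff_cutoff r).contDiffAt.comp u hq).mul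
      (hfs.sub hf))).congr_of_eventuallyEq ?_
    filter_upwards [h4] with v hv using tubeSmoothing_of_tubeRel hT hv

theorem contDiffAt_tubeSmoothing (hT : TubeData r Ω A σ f h Z g) {u₀ : Fin m → ℝ} (hu₀ : u₀ ∈ Ω)
    (hA : u₀ ∈ A → ∃ b, TubeRel r A σ f Z g u₀ b) :
    ContDiffAt ℝ r (tubeSmoothing r A σ f Z g) u₀ := by
  by_cases hN : ∃ b, TubeRel r A σ f Z g u₀ b
  · obtain ⟨b, hR⟩ := hN
    exact contDiffAt_tubeSmoothing_of_tubeRel hT hR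
  · have hA' : u₀ ∉ A := fun h => hN (hA h)
    exact (hT.contDiffAt u₀ ⟨hu₀, hA'⟩).congr_of_eventuallyEq
      (tubeSmoothing_eventuallyEq hT hu₀ hN fun _ => hA')

theorem continuousAt_tubeSmoothing (hT : TubeData r Ω A σ f h Z g) {u₀ : Fin m → ℝ}
    (hu₀ : u₀ ∈ Ω) : ContinuousAt (tubeSmoothing r A σ f Z g) u₀ := by
  by_cases hA : u₀ ∈ A → ∃ b, TubeRel r A σ f Z g u₀ b
  · exact (contDiffAt_tubeSmoothing hT hu₀ hA).continuousAt
  have hN : ¬ ∃ b, TubeRel r A σ f Z g u₀ b := by tauto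
  have hf := hT.continuousAt u₀ hu₀
  by_cases hZ : coordProj k σ u₀ ∈ Z
  · rw [ContinuousAt, tubeSmoothing_of_not hN, Metric.tendsto_nhds]
    intro ε hε
    obtain ⟨δ, hδ, h1⟩ := Metric.eventually_nhds_iff.1
      (Metric.tendsto_nhds.1 hf (ε / 3) (by positivity))
    filter_upwards [Metric.ball_mem_nhds u₀ (by positivity : 0 < δ / 3)] with u hu
    rw [Metric.mem_ball] at hu
    have h2 := h1 (show dist u u₀ < δ by linarith)
    by_cases hN' : ∃ b, TubeRel r A σ f Z g u b
    · obtain ⟨b, hR⟩ := hN'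
      have h3 := hT.dist_lt hR
      have h4 := hT.radius_le _ hR.notMem _ hZ
      have h5 := dist_coordProj_le σ u u₀
      have h6 := h1 (show dist b u₀ < δ by linarith [dist_triangle_left b u₀ u])
      have h7 := abs_tubeSmoothing_sub_le_of_tubeRel hT hR
      rw [← Real.dist_eq, ← Real.dist_eq] at h7
      linarith [dist_triangle (tubeSmoothing r A σ f Z g u) (f u) (f u₀),
        dist_triangle_right (f b) (f u) (f u₀)]
    · rw [tubeSmoothing_of_not hN']
      linarith
  · exact hf.congr (tubeSmoothing_eventuallyEq hT hu₀ hN fun h => absurd h hZ).symm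

section Definability

variable {L} [hF : Fact (ExpandsOrderedField L)]

theorem defP_near (hΩ : Def L m Ω) (hA : Def L m A) (hf : DefFn L f) (hh : DefFn L h) :
    DefP L fun z : (Fin m → ℝ) × (Fin m → ℝ) => Near r Ω A σ f h z.1 z.2 := by
  have h1 : DefP L fun z : (Fin m → ℝ) × (Fin m → ℝ) => z.2 ∈ Ω ∧
      (z.2 ∈ A → z.2 ∈ {a | RegAt r A σ f a}) ∧
      (z.2 ∈ A → coordProj k σ z.2 = coordProj k σ z.1 → z.2 = z.1) ∧
      |f z.2 - f z.1| < h z.2 := by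
    refine DefP.and (DefP.mem hΩ ?_) (DefP.and (DefP.imp (DefP.mem hA ?_)
      (DefP.mem (hA.regAt σ hf) ?_)) (DefP.and (DefP.imp (DefP.mem hA ?_) (DefP.imp
      (DefP.eq ?_ ?_) (DefP.eq ?_ ?_))) (DefP.lt ?_ ?_))) <;> fun_prop
  exact h1.congr fun z => ⟨fun ⟨a, b, c, d⟩ => ⟨a, b, c, d⟩, fun ⟨a, b, c, d⟩ => ⟨a, b, c, d⟩⟩

theorem defFn_nearRadius (hΩ : Def L m Ω) (hA : Def L m A) (hf : DefFn L f) (hh : DefFn L h) :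
    DefFn L (nearRadius r Ω A σ f h) := by
  have h1 := hA.regAt (r := r) σ hf
  refine DefFn.sSup (p := fun x t => t ≤ 1 ∧ ∀ a, a ∈ {a | RegAt r A σ f a} → coordProj k σ a = x →
    ∀ u, dist u a < t → Near r Ω A σ f h a u) ?_
  refine DefP.and (DefP.le ?_ ?_) (DefP.all (DefP.imp (DefP.mem h1 ?_) (DefP.imp (DefP.eq ?_ ?_)
    (DefP.all (DefP.imp (DefP.lt ?_ ?_) ((defP_near hΩ hA hf hh).comp
      (f := fun z : (((Fin k → ℝ) × ℝ) × (Fin m → ℝ)) × (Fin m → ℝ) => (z.1.2, z.2)) ?_)))))) <;>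
    fun_prop

theorem defP_tubeRel (hA : Def L m A) (hf : DefFn L f) (hZ : Def L k Z) (hg : DefFn L g) :
    DefP L fun z : (Fin m → ℝ) × (Fin m → ℝ) => TubeRel r A σ f Z g z.1 z.2 := by
  have h1 : DefP L fun z : (Fin m → ℝ) × (Fin m → ℝ) => ¬ coordProj k σ z.1 ∈ Z ∧
      z.2 ∈ {a | RegAt r A σ f a} ∧ coordProj k σ z.2 = coordProj k σ z.1 ∧
      ∑ j, (z.1 j - z.2 j) ^ 2 < g (coordProj k σ z.1) ^ 2 := by
    refine DefP.and (DefP.not (DefP.mem hZ ?_)) (DefP.and (DefP.mem (hA.regAt σ hf) ?_)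
      (DefP.and (DefP.eq ?_ ?_) (DefP.lt ?_ ?_))) <;> fun_prop
  exact h1.congr fun z => ⟨fun ⟨a, b, c, d⟩ => ⟨a, b, c, d⟩, fun ⟨a, b, c, d⟩ => ⟨a, b, c, d⟩⟩

theorem defFn_tubeSmoothing (hT : TubeData r Ω A σ f h Z g) (hA : Def L m A) (hf : DefFn L f)
    (hZ : Def L k Z) (hg : DefFn L g) : DefFn L (tubeSmoothing r A σ f Z g) := by
  have h1 := defP_tubeRel (r := r) (σ := σ) hA hf hZ hg
  have h2 := DefFn.select h1 hT.unique
  have h3 := h1.ex (p := fun u b => TubeRel r A σ f Z g u b)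
  classical
  unfold tubeSmoothing
  refine DefFn.ite h3 ?_ hf
  fun_prop

end Definability

end Smoothing

section SmoothApproximation

/-- Definable continuous functions that are `C^r` off a closed set of dimension less than `k` can
be approximated by definable `C^r` functions. -/
def Smoothable (r k : ℕ) : Prop :=
  ∀ (m : ℕ) (Ω A : Set (Fin m → ℝ)) (f h : (Fin m → ℝ) → ℝ), Def L m Ω → IsOpen Ω → Def L m A →
    A ⊆ Ω → IsOpen (Ω \ A) → DimLt L k A → DefFn L f → (∀ x ∈ Ω, ContinuousAt f x) →
    (∀ x ∈ Ω \ A, ContDiffAt ℝ r f x) → DefFn L h → (∀ x ∈ Ω, ContinuousAt h x) →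
    (∀ x ∈ Ω, 0 < h x) →
    ∃ f', DefFn L f' ∧ (∀ x ∈ Ω, ContDiffAt ℝ r f' x) ∧ ∀ x ∈ Ω, |f' x - f x| ≤ h x

variable {L} {m k r : ℕ}

theorem smoothable_zero : Smoothable L r 0 := by
  intro m Ω A f h _ _ _ _ _ hdim hf _ hs _ _ hpos
  refine ⟨f, hf, fun x hx => hs x ⟨hx, ?_⟩, fun x hx => by simpa using (hpos x hx).le⟩
  rw [hdim.eq_empty]
  exact notMem_empty x

variable [hF : Fact (ExpandsOrderedField L)]

theorem isOpen_contDiffAt {Ω : Set (Fin m → ℝ)} (hΩ : IsOpen Ω) {f : (Fin m → ℝ) → ℝ} :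
    IsOpen (Ω \ {x ∈ Ω | ¬ ContDiffAt ℝ r f x}) := by
  rw [isOpen_iff_mem_nhds]
  rintro x ⟨hx, hx'⟩
  have h : ContDiffAt ℝ r f x := by
    by_contra hn
    exact hx' ⟨hx, hn⟩
  filter_upwards [hΩ.mem_nhds hx, h.eventually (by simp)] with y hy hy'
  exact ⟨hy, fun hn => hn.2 hy'⟩

theorem def_not_contDiffAt {Ω : Set (Fin m → ℝ)} (hΩ : Def L m Ω) {f : (Fin m → ℝ) → ℝ}
    (hf : DefFn L f) : Def L m {x ∈ Ω | ¬ ContDiffAt ℝ r f x} := by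
  refine DefP.def (DefP.and hΩ.defP (DefP.not (DefP.contDiffAt (α := Fin m → ℝ) r
    (F := fun _ => f) ?_ ?_))) <;> fun_prop

variable [hO : Fact (LocallyOMinimal L)]

theorem Smoothable.exists_radius (hk : Smoothable L r k) {θ : (Fin k → ℝ) → ℝ} (hθ : DefFn L θ)
    (hthin : Thin L {x | θ x ≤ 0}) : ∃ (Z : Set (Fin k → ℝ)) (g : (Fin k → ℝ) → ℝ), IsClosed Z ∧
      Thin L Z ∧ DefFn L g ∧ ∀ x ∉ Z, 0 < g x ∧ ContDiffAt ℝ r g x ∧ 2 * g x ≤ θ x ∧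
      ∀ c ∈ Z, g x ≤ 2 * dist x c := by
  obtain ⟨Z, hZ⟩ : ∃ Z, Z = closure {x | θ x ≤ 0} ∪ closure {x | ¬ ContinuousAt θ x} := ⟨_, rfl⟩
  have hZc : IsClosed Z := hZ ▸ isClosed_closure.union isClosed_closure
  have hZt : Thin L Z := hZ ▸ hthin.closure.union (thin_not_continuousAt hθ).closure
  have hpos : ∀ x ∉ Z, 0 < θ x := fun x hx => by
    by_contra! hn
    exact hx (hZ ▸ Or.inl (subset_closure hn))
  have hcont : ∀ x ∉ Z, ContinuousAt θ x := fun x hx => by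
    by_contra hn
    exact hx (hZ ▸ Or.inr (subset_closure hn))
  have hD : DefFn L fun x => distTo Z x := DefFn.distTo hZt.isDef (by fun_prop)
  obtain ⟨θ₁, hθ₁⟩ : ∃ θ₁ : (Fin k → ℝ) → ℝ, θ₁ = fun x => min (θ x / 4) (distTo Z x) := ⟨_, rfl⟩
  have hd1 : DefFn L θ₁ := by
    rw [hθ₁]
    fun_prop
  have hc1 : ∀ x ∈ Zᶜ, ContinuousAt θ₁ x := fun x hx => by
    rw [hθ₁]
    exact Filter.Tendsto.min ((hcont x hx).div_const 4) (continuous_distTo Z).continuousAt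
  have hp1 : ∀ x ∈ Zᶜ, 0 < θ₁ x := fun x hx => by
    have h1 := hpos x hx
    rw [hθ₁]
    exact lt_min (by positivity) (distTo_pos hZc hx)
  have hT : Thin L {x ∈ Zᶜ | ¬ ContDiffAt ℝ r θ₁ x} :=
    (thin_not_contDiffAt r hd1).mono (def_not_contDiffAt hZt.isDef.compl hd1) fun x hx => hx.2
  obtain ⟨g, hg1, hg2, hg3⟩ := hk k Zᶜ _ θ₁ (fun x => θ₁ x / 2) hZt.isDef.compl
    hZc.isOpen_compl hT.isDef (fun x hx => hx.1) (isOpen_contDiffAt hZc.isOpen_compl)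
    hT.dimLt hd1 hc1 (fun x hx => by_contra fun hn => hx.2 ⟨hx.1, hn⟩)
    (by fun_prop) (fun x hx => (hc1 x hx).div_const 2) (fun x hx => half_pos (hp1 x hx))
  refine ⟨Z, g, hZc, hZt, hg1, fun x hx => ?_⟩
  obtain ⟨h1, h2⟩ := abs_le.1 (hg3 x hx)
  have h3 := hp1 x hx
  have h4 : θ₁ x ≤ θ x / 4 := hθ₁ ▸ min_le_left _ _
  have h5 : θ₁ x ≤ distTo Z x := hθ₁ ▸ min_le_right _ _
  have h6 := hpos x hx
  refine ⟨by linarith, hg2 x hx, by linarith, fun c hc => ?_⟩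
  linarith [distTo_le_dist x hc, dist_nonneg (x := x) (y := c)]

theorem Smoothable.step (hk : Smoothable L r k) {Ω A : Set (Fin m → ℝ)} {f h : (Fin m → ℝ) → ℝ}
    (hΩ : Def L m Ω) (hΩo : IsOpen Ω) (hA : Def L m A) (hAΩ : A ⊆ Ω) (hdiff : IsOpen (Ω \ A))
    (hdim : DimLt L (k + 1) A) (hf : DefFn L f) (hfc : ∀ x ∈ Ω, ContinuousAt f x)
    (hfs : ∀ x ∈ Ω \ A, ContDiffAt ℝ r f x) (hh : DefFn L h) (hhc : ∀ x ∈ Ω, ContinuousAt h x)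
    (hhp : ∀ x ∈ Ω, 0 < h x) (σ : Fin k → Fin m) :
    ∃ A' f', Def L m A' ∧ A' ⊆ A ∧ IsOpen (Ω \ A') ∧ Thin L (coordProj k σ '' A') ∧ DefFn L f' ∧
      (∀ x ∈ Ω, ContinuousAt f' x) ∧ (∀ x ∈ Ω \ A', ContDiffAt ℝ r f' x) ∧
      ∀ x ∈ Ω, |f' x - f x| ≤ h x := by
  have hθ := defFn_nearRadius (r := r) (σ := σ) hΩ hA hf hh
  have hthin : Thin L {x | nearRadius r Ω A σ f h x ≤ 0} := by
    obtain ⟨T, hT, hT'⟩ := hdim.exists_thin_infinite σ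
    refine hT.mono (DefP.def (DefP.le hθ (by fun_prop))) fun x hx => ?_
    by_contra hxT
    exact not_lt.2 hx (nearRadius_pos hΩo hAΩ hfc hhc hhp (hT' x hxT))
  obtain ⟨Z, g, hZc, hZt, hg, hgZ⟩ := hk.exists_radius hθ hthin
  have hT : TubeData r Ω A σ f h Z g :=
    ⟨hdiff, hfc, hfs, hhp, hZc, fun x hx => (hgZ x hx).1, fun x hx => (hgZ x hx).2.1,
      fun x hx => (hgZ x hx).2.2.2, fun a ha haZ u hu =>
        near_of_dist_lt ha (hu.trans_le (hgZ _ haZ).2.2.1)⟩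
  have hRd := defP_tubeRel (r := r) (σ := σ) hA hf hZt.isDef hg
  have hA' : Def L m {a ∈ A | ¬ ∃ b, TubeRel r A σ f Z g a b} :=
    DefP.def (hA.defP.and (hRd.ex (p := fun u b => TubeRel r A σ f Z g u b)).not)
  refine ⟨{a ∈ A | ¬ ∃ b, TubeRel r A σ f Z g a b}, tubeSmoothing r A σ f Z g, hA',
    fun a ha => ha.1, ?_, ?_, defFn_tubeSmoothing hT hA hf hZt.isDef hg,
    fun x hx => continuousAt_tubeSmoothing hT hx,
    fun x hx => contDiffAt_tubeSmoothing hT hx.1 fun hxA => by_contra fun hn => hx.2 ⟨hxA, hn⟩,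
    fun x hx => abs_tubeSmoothing_sub_le hT hx⟩
  · have h1 : Ω \ {a ∈ A | ¬ ∃ b, TubeRel r A σ f Z g a b} =
        (Ω \ A) ∪ {u | ∃ b, TubeRel r A σ f Z g u b} := by
      ext u
      constructor
      · rintro ⟨h1, h2⟩
        by_cases hu : u ∈ A
        · exact Or.inr (by_contra fun hn => h2 ⟨hu, hn⟩)
        · exact Or.inl ⟨h1, hu⟩
      · rintro (h1 | ⟨b, hb⟩)
        · exact ⟨h1.1, fun h => h1.2 h.1⟩
        · exact ⟨(hT.near_of_tubeRel hb).mem, fun h => h.2 ⟨b, hb⟩⟩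
    rw [h1]
    exact hdiff.union hT.isOpen_tube
  · refine ((hdim.thin_not_regAt r hA σ hf).union hZt).mono (hA'.image (by fun_prop)) ?_
    rintro _ ⟨a, ⟨ha, hN⟩, rfl⟩
    by_cases hr : RegAt r A σ f a
    · refine Or.inr (by_contra fun hZ => hN ⟨a, hZ, hr, rfl, ?_⟩)
      simpa using pow_pos (hT.radius_pos _ hZ) 2
    · exact Or.inl ⟨a, ⟨ha, hr⟩, rfl⟩

theorem Smoothable.succ (hk : Smoothable L r k) : Smoothable L r (k + 1) := by
  intro m Ω A f h hΩ hΩo hA hAΩ hdiff hdim hf hfc hfs hh hhc hhp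
  have key : ∀ (F : Finset (Fin k → Fin m)) (A : Set (Fin m → ℝ)) (f h : (Fin m → ℝ) → ℝ),
      Def L m A → A ⊆ Ω → IsOpen (Ω \ A) → DimLt L (k + 1) A →
      (∀ τ ∉ F, Thin L (coordProj k τ '' A)) → DefFn L f → (∀ x ∈ Ω, ContinuousAt f x) →
      (∀ x ∈ Ω \ A, ContDiffAt ℝ r f x) → DefFn L h → (∀ x ∈ Ω, ContinuousAt h x) →
      (∀ x ∈ Ω, 0 < h x) →
      ∃ f', DefFn L f' ∧ (∀ x ∈ Ω, ContDiffAt ℝ r f' x) ∧ ∀ x ∈ Ω, |f' x - f x| ≤ h x := by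
    intro F
    induction F using Finset.induction_on with
    | empty =>
      intro A f h hA hAΩ hdiff _ hF hf hfc hfs hh hhc hhp
      exact hk m Ω A f h hΩ hΩo hA hAΩ hdiff (fun τ => hF τ (by simp)) hf hfc hfs hh hhc hhp
    | insert σ F _ ih =>
      intro A f h hA hAΩ hdiff hdim hF hf hfc hfs hh hhc hhp
      have hh2 : DefFn L fun x => h x / 2 := by fun_prop
      obtain ⟨A', f₁, h1, h2, h3, h4, h5, h6, h7, h8⟩ := hk.step (h := fun x => h x / 2) hΩ hΩo hA
        hAΩ hdiff hdim hf hfc hfs hh2 (fun x hx => (hhc x hx).div_const 2)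
        (fun x hx => half_pos (hhp x hx)) σ
      obtain ⟨f', h9, h10, h11⟩ := ih A' f₁ (fun x => h x / 2) h1 (h2.trans hAΩ) h3
        (fun τ => (hdim τ).mono (h1.image (by fun_prop)) (image_mono h2))
        (fun τ hτ => by
          by_cases hτσ : τ = σ
          · rw [hτσ]
            exact h4
          · exact (hF τ (by simp [hτ, hτσ])).mono (h1.image (by fun_prop)) (image_mono h2))
        h5 h6 h7 hh2 (fun x hx => (hhc x hx).div_const 2) (fun x hx => half_pos (hhp x hx))
      refine ⟨f', h9, h10, fun x hx => ?_⟩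
      have := abs_sub_le (f' x) (f₁ x) (f x)
      linarith [h8 x hx, h11 x hx]
  exact key Finset.univ A f h hA hAΩ hdiff hdim (by simp) hf hfc hfs hh hhc hhp

theorem smoothable (k : ℕ) : Smoothable L r k := by
  induction k with
  | zero => exact smoothable_zero
  | succ k ih => exact ih.succ

/-- Approximation of definable continuous functions by definable `C^r` functions. -/
theorem exists_contDiff_approx (r : ℕ) {Ω : Set (Fin m → ℝ)} {f h : (Fin m → ℝ) → ℝ}
    (hΩ : Def L m Ω) (hΩo : IsOpen Ω) (hf : DefFn L f) (hfc : ∀ x ∈ Ω, ContinuousAt f x)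
    (hh : DefFn L h) (hhc : ∀ x ∈ Ω, ContinuousAt h x) (hhp : ∀ x ∈ Ω, 0 < h x) :
    ∃ f', DefFn L f' ∧ (∀ x ∈ Ω, ContDiffAt ℝ r f' x) ∧ ∀ x ∈ Ω, |f' x - f x| ≤ h x :=
  have hA := def_not_contDiffAt (r := r) hΩ hf
  smoothable (m + 1) m Ω _ f h hΩ hΩo hA (fun _ hx => hx.1) (isOpen_contDiffAt hΩo)
    (dimLt_succ_self hA) hf hfc (fun _ hx => by_contra fun hn => hx.2 ⟨hx.1, hn⟩) hh hhc hhp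

end SmoothApproximation

section Retractions

/-- The set `S` is a definable `C^r` retract of a definable open neighbourhood. -/
def HasRetraction (r : ℕ) {m : ℕ} (S : Set (Fin m → ℝ)) : Prop :=
  ∃ (W : Set (Fin m → ℝ)) (ρ : (Fin m → ℝ) → (Fin m → ℝ)), Def L m W ∧ IsOpen W ∧ S ⊆ W ∧
    DefFn L ρ ∧ (∀ u ∈ W, ContDiffAt ℝ r ρ u ∧ ρ u ∈ S) ∧ ∀ x ∈ S, ρ x = x

variable {L} {m k r : ℕ}

theorem hasRetraction_empty : HasRetraction L r (∅ : Set (Fin m → ℝ)) :=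
  ⟨∅, id, (DefP.const False).def, isOpen_empty, subset_rfl, DefFn.id', fun _ h => h.elim,
    fun _ h => h.elim⟩

variable [hF : Fact (ExpandsOrderedField L)]

/-- The point `u` is projected to the point `b` of `S` by the retraction along the fibres of a
coordinate projection. -/
def ProjRel (S : Set (Fin m → ℝ)) (σ : Fin k → Fin m) (u b : Fin m → ℝ) : Prop :=
  b ∈ S ∧ coordProj k σ b = coordProj k σ u ∧ ∃ t : ℝ, dist u b < t ∧
    ∀ c, c ∈ S → dist c b < 2 * t → ∀ c', c' ∈ S → dist c' b < 2 * t →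
      coordProj k σ c = coordProj k σ c' → c = c'

variable {S : Set (Fin m → ℝ)} {σ : Fin k → Fin m}

theorem defP_projRel (hS : Def L m S) :
    DefP L fun z : (Fin m → ℝ) × (Fin m → ℝ) => ProjRel S σ z.1 z.2 := by
  unfold ProjRel
  refine DefP.and (DefP.mem hS ?_) (DefP.and (DefP.eq ?_ ?_) (DefP.ex (DefP.and (DefP.lt ?_ ?_)
    (DefP.all (DefP.imp (DefP.mem hS ?_) (DefP.imp (DefP.lt ?_ ?_) (DefP.all (DefP.imp
    (DefP.mem hS ?_) (DefP.imp (DefP.lt ?_ ?_) (DefP.imp (DefP.eq ?_ ?_)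
    (DefP.eq ?_ ?_))))))))))) <;> fun_prop

theorem ProjRel.unique (u b b' : Fin m → ℝ) (hb : ProjRel S σ u b) (hb' : ProjRel S σ u b') :
    b = b' := by
  obtain ⟨h1, h2, t, h3, h4⟩ := hb
  obtain ⟨h1', h2', t', h3', h4'⟩ := hb'
  have h5 := dist_triangle_left b b' u
  have h6 := dist_nonneg (x := b) (y := b')
  rcases le_total t t' with h | h
  · exact h4' b h1 (by linarith) b' h1' (by rw [dist_self]; linarith) (h2.trans h2'.symm)
  · exact h4 b h1 (by rw [dist_self]; linarith) b' h1' (by rw [dist_comm]; linarith)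
      (h2.trans h2'.symm)

theorem ProjRel.eventually (u b : Fin m → ℝ) (h : ProjRel S σ u b) :
    ∀ᶠ z in 𝓝 (u, b), z.2 ∈ S → coordProj k σ z.2 = coordProj k σ z.1 → ProjRel S σ z.1 z.2 := by
  obtain ⟨h1, h2, t, h3, h4⟩ := h
  obtain ⟨t', ht, ht'⟩ := exists_between h3
  have h5 : ContinuousAt (fun z : (Fin m → ℝ) × (Fin m → ℝ) => dist z.1 z.2) (u, b) :=
    Continuous.continuousAt (by fun_prop)
  have h6 : ContinuousAt (fun z : (Fin m → ℝ) × (Fin m → ℝ) => dist z.2 b) (u, b) :=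
    Continuous.continuousAt (by fun_prop)
  filter_upwards [h5.eventually_lt_const ht, h6.eventually_lt_const
    (show _ < 2 * (t - t') by simpa using ht')] with z h7 h8 h9 h10
  refine ⟨h9, h10, t', h7, fun c hc hcz c' hc' hcz' hπ => h4 c hc ?_ c' hc' ?_ hπ⟩
  · linarith [dist_triangle c z.2 b]
  · linarith [dist_triangle c' z.2 b]

theorem hasRetraction_of_regAt (hS : Def L m S) {f : (Fin m → ℝ) → ℝ}
    (hreg : ∀ a ∈ S, RegAt r S σ f a) : HasRetraction L r S := by
  have hR := defP_projRel (σ := σ) hS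
  have hproj : ∀ u b, ProjRel S σ u b → b ∈ S ∧ coordProj k σ b = coordProj k σ u :=
    fun u b h => ⟨h.1, h.2.1⟩
  have hself : ∀ a ∈ S, ProjRel S σ a a := by
    intro a ha
    obtain ⟨-, s, -, -, -, -, h⟩ := hreg a ha
    obtain ⟨ε, hε, h⟩ := Metric.eventually_nhds_iff.1 h
    refine ⟨ha, rfl, ε / 2, by simpa using hε, fun c hc h1 c' hc' h2 hπ => ?_⟩
    rw [h (by linarith : dist c a < ε) hc, h (by linarith : dist c' a < ε) hc', hπ]
  refine ⟨{u | ∃ b, ProjRel S σ u b}, select (ProjRel S σ),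
    (hR.ex (p := fun u b => ProjRel S σ u b)).def, isOpen_of_open hreg hproj ProjRel.eventually,
    fun a ha => ⟨a, hself a ha⟩, DefFn.select hR ProjRel.unique, fun u hu => ?_,
    fun x hx => select_eq ProjRel.unique (hself x hx)⟩
  refine ⟨?_, (select_spec hu).1⟩
  obtain ⟨b, hb⟩ := hu
  obtain ⟨s, h1, -, -, h2⟩ := exists_section_of_open hreg hproj ProjRel.eventually hb
  refine (h1.comp u (contDiff_coordProj σ).contDiffAt).congr_of_eventuallyEq ?_
  filter_upwards [h2] with v hv using select_eq ProjRel.unique hv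

theorem HasRetraction.restrict {S X : Set (Fin m → ℝ)} (h : HasRetraction L r S) (hS : Def L m S)
    (hX : Def L m X) (hSX : ∀ a ∈ S, ∀ᶠ b in 𝓝 a, b ∈ X → b ∈ S) :
    ∃ (W : Set (Fin m → ℝ)) (ρ : (Fin m → ℝ) → (Fin m → ℝ)), Def L m W ∧ IsOpen W ∧ S ⊆ W ∧
      DefFn L ρ ∧ (∀ u ∈ W, ContDiffAt ℝ r ρ u ∧ ρ u ∈ S) ∧ (∀ x ∈ S, ρ x = x) ∧
      ∀ x ∈ W, x ∈ X → x ∈ S := by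
  obtain ⟨W, ρ, h1, h2, h3, h4, h5, h6⟩ := h
  refine ⟨W ∩ interior {u | u ∈ X → u ∈ S}, ρ,
    h1.inter (Def.interior (hX.defP.imp hS.defP).def), h2.inter isOpen_interior,
    fun a ha => ⟨h3 ha, mem_interior_iff_mem_nhds.2 (hSX a ha)⟩, h4, fun u hu => h5 u hu.1, h6,
    fun x hx => interior_subset hx.2⟩

variable [hO : Fact (LocallyOMinimal L)]

/-- A definable `C^r` function on the union of two definable open sets separating their
complements. -/
theorem exists_separating {W₁ W₂ : Set (Fin m → ℝ)} (h1 : Def L m W₁) (h2 : Def L m W₂)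
    (ho1 : IsOpen W₁) (ho2 : IsOpen W₂) (r : ℕ) :
    ∃ c : (Fin m → ℝ) → ℝ, DefFn L c ∧ (∀ u ∈ W₁ ∪ W₂, ContDiffAt ℝ r c u) ∧
      (∀ u ∈ W₁, u ∉ W₂ → ∀ᶠ v in 𝓝 u, c v = 0) ∧ ∀ u ∈ W₂, u ∉ W₁ → ∀ᶠ v in 𝓝 u, c v = 1 := by
  have hd1 : DefFn L (distTo W₁ᶜ) := DefFn.distTo h1.compl (by fun_prop)
  have hd2 : DefFn L (distTo W₂ᶜ) := DefFn.distTo h2.compl (by fun_prop)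
  have hpos : ∀ u ∈ W₁ ∪ W₂, 0 < distTo W₁ᶜ u + distTo W₂ᶜ u := by
    rintro u (hu | hu)
    · exact add_pos_of_pos_of_nonneg (distTo_pos ho1.isClosed_compl (not_not.2 hu))
        (distTo_nonneg _ _)
    · exact add_pos_of_nonneg_of_pos (distTo_nonneg _ _)
        (distTo_pos ho2.isClosed_compl (not_not.2 hu))
  obtain ⟨f, hf, hfs, hfa⟩ := exists_contDiff_approx r
    (f := fun u => distTo W₁ᶜ u / (distTo W₁ᶜ u + distTo W₂ᶜ u)) (h := fun _ => 1 / 8)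
    (h1.union h2) (ho1.union ho2) (by fun_prop)
    (fun u hu => (continuous_distTo _).continuousAt.div
      ((continuous_distTo _).add (continuous_distTo _)).continuousAt (hpos u hu).ne')
    (by fun_prop) (fun _ _ => continuousAt_const) (fun _ _ => by norm_num)
  refine ⟨fun u => cutoff r (f u), by fun_prop,
    fun u hu => (contDiff_cutoff r).contDiffAt.comp u (hfs u hu), fun u hu hu' => ?_,
    fun u hu hu' => ?_⟩
  · have h3 := hpos u (Or.inl hu)
    have h4 := hfa u (Or.inl hu)
    have h5 : distTo W₂ᶜ u = 0 := distTo_eq_zero hu'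
    rw [h5, add_zero] at h3
    rw [h5, add_zero, div_self h3.ne'] at h4
    filter_upwards [(hfs u (Or.inl hu)).continuousAt.eventually_const_lt
      (show 1 / 2 < f u by linarith [(abs_le.1 h4).1])] with v hv using cutoff_eq_zero r hv.le
  · have h4 := hfa u (Or.inr hu)
    have h5 : distTo W₁ᶜ u = 0 := distTo_eq_zero hu'
    rw [h5, zero_div, sub_zero] at h4
    filter_upwards [(hfs u (Or.inr hu)).continuousAt.eventually_lt_const
      (show f u < 1 / 4 by linarith [(abs_le.1 h4).2])] with v hv using cutoff_eq_one r hv.le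

theorem HasRetraction.union {S₁ S₂ X : Set (Fin m → ℝ)} (hr1 : HasRetraction L r S₁)
    (hr2 : HasRetraction L r S₂) (hS1 : Def L m S₁) (hS2 : Def L m S₂) (hX : Def L m X)
    (hX1 : S₁ ⊆ X) (hX2 : S₂ ⊆ X) (ho1 : ∀ a ∈ S₁, ∀ᶠ b in 𝓝 a, b ∈ X → b ∈ S₁)
    (ho2 : ∀ a ∈ S₂, ∀ᶠ b in 𝓝 a, b ∈ X → b ∈ S₂) : HasRetraction L r (S₁ ∪ S₂) := by
  obtain ⟨W₁, ρ₁, hW1, hWo1, hSW1, hρ1, hs1, hid1, hWX1⟩ := hr1.restrict hS1 hX ho1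
  obtain ⟨W₂, ρ₂, hW2, hWo2, hSW2, hρ2, hs2, hid2, hWX2⟩ := hr2.restrict hS2 hX ho2
  obtain ⟨c, hc, hcs, hc0, hc1⟩ := exists_separating hW1 hW2 hWo1 hWo2 r
  obtain ⟨p, hp⟩ : ∃ p : (Fin m → ℝ) → (Fin m → ℝ),
    p = fun u => (1 - c u) • ρ₁ u + c u • ρ₂ u := ⟨_, rfl⟩
  have hpd : DefFn L p := by
    rw [hp]
    fun_prop
  have hp1 : ∀ u ∈ W₁, u ∉ W₂ → p =ᶠ[𝓝 u] ρ₁ := fun u h h' => by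
    filter_upwards [hc0 u h h'] with v hv
    simp [hp, hv]
  have hp2 : ∀ u ∈ W₂, u ∉ W₁ → p =ᶠ[𝓝 u] ρ₂ := fun u h h' => by
    filter_upwards [hc1 u h h'] with v hv
    simp [hp, hv]
  have hps : ∀ u ∈ W₁ ∪ W₂, ContDiffAt ℝ r p u := by
    intro u hu
    by_cases h1 : u ∈ W₁
    · by_cases h2 : u ∈ W₂
      · rw [hp]
        exact ((contDiffAt_const.sub (hcs u hu)).smul (hs1 u h1).1).add
          ((hcs u hu).smul (hs2 u h2).1)
      · exact (hs1 u h1).1.congr_of_eventuallyEq (hp1 u h1 h2)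
    · have h2 := hu.resolve_left h1
      exact (hs2 u h2).1.congr_of_eventuallyEq (hp2 u h2 h1)
  have hpid : ∀ x ∈ S₁ ∪ S₂, p x = x := by
    intro x hx
    by_cases h1 : x ∈ W₁
    · have h1' : x ∈ S₁ := hWX1 x h1 (hx.elim (fun h => hX1 h) fun h => hX2 h)
      by_cases h2 : x ∈ W₂
      · have h2' : x ∈ S₂ := hWX2 x h2 (hX1 h1')
        simp [hp, hid1 x h1', hid2 x h2', ← add_smul]
      · rw [(hp1 x h1 h2).self_of_nhds, hid1 x h1']
    · have h2' : x ∈ S₂ := hx.resolve_left fun h => h1 (hSW1 h)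
      rw [(hp2 x (hSW2 h2') h1).self_of_nhds, hid2 x h2']
  classical
  have hpre : Def L m (p ⁻¹' W₁) := hW1.preimage hpd
  refine ⟨(W₁ ∪ W₂) ∩ (interior (p ⁻¹' (S₁ ∪ S₂)) ∪ p ⁻¹' W₁),
    fun u => if u ∈ p ⁻¹' W₁ then ρ₁ (p u) else p u,
    (hW1.union hW2).inter (((hS1.union hS2).preimage hpd).interior.union hpre), ?_, ?_,
    DefFn.ite hpre.defP (hρ1.comp hpd) hpd, ?_, ?_⟩
  · rw [isOpen_iff_mem_nhds]
    rintro u ⟨hu, h | h⟩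
    · filter_upwards [(hWo1.union hWo2).mem_nhds hu, isOpen_interior.mem_nhds h] with v h1 h2
      exact ⟨h1, Or.inl h2⟩
    · filter_upwards [(hWo1.union hWo2).mem_nhds hu,
        (hps u hu).continuousAt.preimage_mem_nhds (hWo1.mem_nhds h)] with v h1 h2
      exact ⟨h1, Or.inr h2⟩
  · intro x hx
    refine ⟨hx.imp (fun h => hSW1 h) fun h => hSW2 h, ?_⟩
    by_cases h1 : x ∈ W₁
    · refine Or.inr ?_
      rwa [mem_preimage, hpid x hx]
    · have h2 : x ∈ W₂ := hSW2 (hx.resolve_left fun h => h1 (hSW1 h))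
      refine Or.inl (mem_interior_iff_mem_nhds.2 ?_)
      filter_upwards [hp2 x h2 h1, hWo2.mem_nhds h2] with v hv hv'
      rw [mem_preimage, hv]
      exact Or.inr (hs2 v hv').2
  · rintro u ⟨hu, h⟩
    constructor
    · rcases h with h | h
      · refine (hps u hu).congr_of_eventuallyEq ?_
        filter_upwards [isOpen_interior.mem_nhds h] with v hv
        have hv' : v ∈ p ⁻¹' (S₁ ∪ S₂) := interior_subset hv
        split_ifs with hv1
        · exact hid1 _ (hWX1 _ hv1 (hv'.elim (fun h => hX1 h) fun h => hX2 h))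
        · rfl
      · refine ((hs1 (p u) h).1.comp u (hps u hu)).congr_of_eventuallyEq ?_
        filter_upwards [(hps u hu).continuousAt.preimage_mem_nhds (hWo1.mem_nhds h)] with v hv
        exact if_pos hv
    · beta_reduce
      split_ifs with h1
      · exact Or.inl (hs1 _ h1).2
      · have h2 : u ∈ p ⁻¹' (S₁ ∪ S₂) := interior_subset (h.resolve_right h1)
        exact h2
  · intro x hx
    have h1 := hpid x hx
    beta_reduce
    split_ifs with h2
    · rw [mem_preimage, h1] at h2
      rw [h1]
      exact hid1 x (hWX1 x h2 (hx.elim (fun h => hX1 h) fun h => hX2 h))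
    · exact h1

/-- A definable set all of whose points are regular for some coordinate projection is a definable
`C^r` retract. -/
theorem hasRetraction_of_forall_exists_regAt {X : Set (Fin m → ℝ)} (hX : Def L m X)
    (hreg : ∀ a ∈ X, ∃ σ : Fin k → Fin m, RegAt r X σ (fun _ => 0) a) : HasRetraction L r X := by
  have hdef : ∀ F : Finset (Fin k → Fin m), Def L m {a | ∃ σ ∈ F, RegAt r X σ (fun _ => 0) a} := by
    intro F
    refine DefP.def (DefP.ex_finite (p := fun σ a => σ ∈ F ∧ RegAt r X σ (fun _ => 0) a) fun σ =>
      DefP.and (DefP.const _) (Def.regAt (f := fun _ => 0) hX σ (by fun_prop)).defP)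
  have hev : ∀ F : Finset (Fin k → Fin m), ∀ a ∈ {a | ∃ σ ∈ F, RegAt r X σ (fun _ => 0) a},
      ∀ᶠ b in 𝓝 a, b ∈ X → b ∈ {a | ∃ σ ∈ F, RegAt r X σ (fun _ => 0) a} := by
    rintro F a ⟨σ, hσ, h⟩
    filter_upwards [h.eventually] with b hb hbX using ⟨σ, hσ, hb hbX⟩
  have key : ∀ F : Finset (Fin k → Fin m),
      HasRetraction L r {a | ∃ σ ∈ F, RegAt r X σ (fun _ => 0) a} := by
    intro F
    induction F using Finset.induction_on with
    | empty => simpa using hasRetraction_empty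
    | insert τ F _ ih =>
      have h1 : {a | ∃ σ ∈ insert τ F, RegAt r X σ (fun _ => 0) a} =
          {a | RegAt r X τ (fun _ => 0) a} ∪ {a | ∃ σ ∈ F, RegAt r X σ (fun _ => 0) a} := by
        ext a
        simp
      have h2 : Def L m {a | RegAt r X τ (fun _ => 0) a} :=
        Def.regAt (f := fun _ => 0) hX τ (by fun_prop)
      rw [h1]
      exact (hasRetraction_of_regAt h2 fun a ha => RegAt.regAt_setOf ha).union ih h2 (hdef F) hX
        (fun a ha => ha.1) (fun a ⟨_, _, ha⟩ => ha.1)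
        (fun a (ha : RegAt r X τ (fun _ => 0) a) => ha.eventually) (hev F)
  have h1 : X = {a | ∃ σ ∈ (Finset.univ : Finset (Fin k → Fin m)), RegAt r X σ (fun _ => 0) a} := by
    ext a
    exact ⟨fun ha => (hreg a ha).imp fun σ h => ⟨Finset.mem_univ σ, h⟩, fun ⟨_, _, ha⟩ => ha.1⟩
  have h2 := key Finset.univ
  rwa [← h1] at h2

end Retractions

section Charts

variable {L} {n d r : ℕ}

/-- An injective linear map into `ℝⁿ` remains injective after projecting to suitable
coordinates. -/
theorem exists_injective_coordProj (B : (Fin d → ℝ) →ₗ[ℝ] (Fin n → ℝ))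
    (hB : Function.Injective B) :
    ∃ σ : Fin d → Fin n, Function.Injective fun y => coordProj d σ (B y) := by
  have key : ∀ {N : ℕ} (f : Fin N → Module.Dual ℝ (Fin d → ℝ)), LinearIndependent ℝ f →
      (∀ i, f i ∈ range fun i : Fin n => (LinearMap.proj i ∘ₗ B : Module.Dual ℝ (Fin d → ℝ))) →
      Submodule.span ℝ (range f) = Submodule.span ℝ
        (range fun i : Fin n => (LinearMap.proj i ∘ₗ B : Module.Dual ℝ (Fin d → ℝ))) →
      ∃ σ : Fin d → Fin n, Function.Injective fun y => coordProj d σ (B y) := by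
    intro N f hf hfm hspan
    have hT : Function.Injective (LinearMap.pi f) := by
      rw [injective_iff_map_eq_zero]
      intro y hy
      have h1 : Submodule.span ℝ (range f) ≤ LinearMap.ker (Module.Dual.eval ℝ (Fin d → ℝ) y) := by
        rw [Submodule.span_le]
        rintro _ ⟨i, rfl⟩
        exact congrFun hy i
      rw [hspan, Submodule.span_le] at h1
      refine (injective_iff_map_eq_zero B).1 hB y (funext fun i => h1 (mem_range_self i))
    have hN : N = d := by
      have h1 := LinearMap.finrank_le_finrank_of_injective hT
      have h2 := hf.fintype_card_le_finrank
      rw [Subspace.dual_finrank_eq] at h2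
      simp only [Module.finrank_fin_fun, Fintype.card_fin] at h1 h2
      omega
    subst hN
    choose σ hσ using hfm
    refine ⟨σ, fun y y' h => hT (funext fun i => ?_)⟩
    have := congrFun h i
    simp only [LinearMap.pi_apply, ← hσ]
    exact this
  obtain ⟨f, h1, h2, h3⟩ := Submodule.exists_fun_fin_finrank_span_eq ℝ
    (range fun i : Fin n => (LinearMap.proj i ∘ₗ B : Module.Dual ℝ (Fin d → ℝ)))
  exact key f h3 h1 h2

theorem mem_image_chart_iff {X U V : Set (Fin n → ℝ)} {φ : (Fin n → ℝ) → (Fin n → ℝ)}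
    (h : φ '' (X ∩ U) = {x ∈ V | ∀ i : Fin n, d ≤ (i : ℕ) → x i = 0}) (x : Fin n → ℝ) :
    (∃ b ∈ X ∩ U, φ b = x) ↔ x ∈ V ∧ ∀ i : Fin n, d ≤ (i : ℕ) → x i = 0 := by
  have := Set.ext_iff.1 h x
  simpa using this

theorem IsDefCrSubmanifold.exists_regAt {X : Set (Fin n → ℝ)} (hX : IsDefCrSubmanifold L r n d X)
    (hr : r ≠ 0) (hd : d ≤ n) {a : Fin n → ℝ} (ha : a ∈ X) :
    ∃ σ : Fin d → Fin n, RegAt r X σ (fun _ => 0) a := by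
  obtain ⟨U, V, φ, ψ, haU, hU, -, h0V, hV, -, -, -, hφ, hψ, -, ⟨hinv1, hinv2⟩, hφa, himg⟩ :=
    hX.2 a ha
  have hr' : (r : WithTop ℕ∞) ≠ 0 := by exact_mod_cast hr
  have himg' := mem_image_chart_iff himg
  obtain ⟨ι, hι⟩ : ∃ ι : (Fin d → ℝ) →L[ℝ] (Fin n → ℝ),
      ∀ y i, ι y i = if h : (i : ℕ) < d then y ⟨i, h⟩ else 0 := by
    refine ⟨ContinuousLinearMap.pi fun i : Fin n =>
      if h : (i : ℕ) < d then ContinuousLinearMap.proj (⟨i, h⟩ : Fin d) else 0, fun y i => ?_⟩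
    by_cases h : (i : ℕ) < d <;> simp [h]
  obtain ⟨κ, hκ⟩ : ∃ κ : (Fin n → ℝ) →L[ℝ] (Fin d → ℝ), ∀ x i, κ x i = x (Fin.castLE hd i) :=
    ⟨ContinuousLinearMap.pi fun i => ContinuousLinearMap.proj (Fin.castLE hd i), fun _ _ => rfl⟩
  have hκι : ∀ y, κ (ι y) = y := fun y => by
    ext i
    rw [hκ, hι, dif_pos (show ((Fin.castLE hd i : Fin n) : ℕ) < d from i.2)]
    rfl
  have hικ : ∀ x : Fin n → ℝ, (∀ i : Fin n, d ≤ (i : ℕ) → x i = 0) → ι (κ x) = x := fun x hx => by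
    ext i
    rw [hι]
    split_ifs with h
    · rw [hκ]
      rfl
    · exact (hx i (not_lt.1 h)).symm
  have hι0 : ∀ (y : Fin d → ℝ) (i : Fin n), d ≤ (i : ℕ) → ι y i = 0 := fun y i hi => by
    rw [hι, dif_neg (not_lt.2 hi)]
  have hψ0 : ψ 0 = a := hφa ▸ hinv1 haU
  have hιV : ∀ᶠ y in 𝓝 (0 : Fin d → ℝ), ι y ∈ V :=
    ι.continuous.continuousAt.eventually_mem (by simpa using hV.mem_nhds h0V)
  have hφc : ContDiffAt ℝ r φ a := hφ.contDiffAt (hU.mem_nhds haU)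
  have hψc : ContDiffAt ℝ r ψ (ι 0) := by
    rw [map_zero]
    exact hψ.contDiffAt (hV.mem_nhds h0V)
  obtain ⟨β, hβ⟩ : ∃ β : (Fin d → ℝ) → (Fin n → ℝ), ∀ y, β y = ψ (ι y) := ⟨_, fun _ => rfl⟩
  have hβ0 : β 0 = a := by rw [hβ, map_zero, hψ0]
  have hβc : ContDiffAt ℝ r β 0 := by
    rw [funext hβ]
    exact hψc.comp 0 ι.contDiff.contDiffAt
  have hβX : ∀ᶠ y in 𝓝 (0 : Fin d → ℝ), β y ∈ X := by
    filter_upwards [hιV] with y hy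
    obtain ⟨b, hb, hb'⟩ := (himg' (ι y)).2 ⟨hy, hι0 y⟩
    rw [hβ, ← hb', hinv1 hb.2]
    exact hb.1
  have hφβ : ∀ᶠ y in 𝓝 (0 : Fin d → ℝ), κ (φ (β y)) = y := by
    filter_upwards [hιV] with y hy
    rw [hβ, hinv2 hy, hκι]
  have hβφ : ∀ᶠ b in 𝓝 a, b ∈ X → β (κ (φ b)) = b := by
    filter_upwards [hU.mem_nhds haU] with b hbU hbX
    rw [hβ, hικ _ ((himg' (φ b)).1 ⟨b, ⟨hbX, hbU⟩, rfl⟩).2, hinv1 hbU]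
  have hβ' : HasFDerivAt β (fderiv ℝ β 0) 0 := (hβc.differentiableAt hr').hasFDerivAt
  have hinj : Function.Injective (fderiv ℝ β 0 : (Fin d → ℝ) →ₗ[ℝ] (Fin n → ℝ)) := by
    have h1 : HasFDerivAt φ (fderiv ℝ φ a) (β 0) := by
      rw [hβ0]
      exact (hφc.differentiableAt hr').hasFDerivAt
    have h2 := (κ.hasFDerivAt.comp 0 (h1.comp 0 hβ')).unique
      ((hasFDerivAt_id (𝕜 := ℝ) (0 : Fin d → ℝ)).congr_of_eventuallyEq hφβ)
    refine Function.LeftInverse.injective (g := fun v => κ (fderiv ℝ φ a v)) fun y => ?_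
    exact congrArg (fun T : (Fin d → ℝ) →L[ℝ] (Fin d → ℝ) => T y) h2
  obtain ⟨σ, hσ⟩ := exists_injective_coordProj _ hinj
  obtain ⟨π, hπ⟩ : ∃ π : (Fin n → ℝ) →L[ℝ] (Fin d → ℝ), ∀ x, π x = coordProj d σ x :=
    ⟨ContinuousLinearMap.pi fun i => ContinuousLinearMap.proj (σ i), fun _ => rfl⟩
  obtain ⟨e, he⟩ : ∃ e : (Fin d → ℝ) ≃L[ℝ] (Fin d → ℝ),
      (e : (Fin d → ℝ) →L[ℝ] (Fin d → ℝ)) = π.comp (fderiv ℝ β 0) := by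
    refine ⟨(LinearEquiv.ofInjectiveEndo (π.comp (fderiv ℝ β 0) :
      (Fin d → ℝ) →L[ℝ] (Fin d → ℝ)).toLinearMap ?_).toContinuousLinearEquiv, ?_⟩
    · intro x y hxy
      apply hσ
      simpa [hπ] using hxy
    · ext
      simp
  obtain ⟨F, hF⟩ : ∃ F : (Fin d → ℝ) → (Fin d → ℝ), ∀ y, F y = coordProj d σ (β y) :=
    ⟨_, fun _ => rfl⟩
  have hF0 : F 0 = coordProj d σ a := by rw [hF, hβ0]
  have hFc : ContDiffAt ℝ r F 0 := by
    rw [funext hF]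
    exact (contDiff_coordProj σ).contDiffAt.comp 0 hβc
  have hF' : HasFDerivAt F (e : (Fin d → ℝ) →L[ℝ] (Fin d → ℝ)) 0 := by
    rw [he]
    refine (π.hasFDerivAt.comp 0 hβ').congr_of_eventuallyEq
      (Filter.Eventually.of_forall fun y => ?_)
    rw [hF, Function.comp_apply, hπ]
  have hFs := hFc.hasStrictFDerivAt' hF' hr'
  obtain ⟨γ, hγ⟩ : ∃ γ, γ = hFc.localInverse hF' hr' := ⟨_, rfl⟩
  have hγ0 : γ (coordProj d σ a) = 0 := by
    rw [← hF0, hγ]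
    exact hFc.localInverse_apply_image hF' hr'
  have hγc : ContDiffAt ℝ r γ (coordProj d σ a) := by
    rw [← hF0, hγ]
    exact hFc.to_localInverse hF' hr'
  have hγt : Filter.Tendsto γ (𝓝 (coordProj d σ a)) (𝓝 0) := hγ0 ▸ hγc.continuousAt.tendsto
  have hFγ : ∀ᶠ x in 𝓝 (coordProj d σ a), F (γ x) = x := by
    rw [← hF0, hγ]
    exact hFs.eventually_right_inverse
  have hγF : ∀ᶠ y in 𝓝 (0 : Fin d → ℝ), γ (F y) = y := by
    rw [hγ]
    exact hFs.eventually_left_inverse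
  refine ⟨σ, ha, fun x => β (γ x), ContDiffAt.comp _ (hγ0.symm ▸ hβc) hγc, contDiffAt_const,
    (congrArg β hγ0).trans hβ0, ?_, ?_⟩
  · filter_upwards [hγt.eventually hβX, hFγ] with x h1 h2
    exact ⟨h1, by rw [← hF, h2]⟩
  · have h1 : Filter.Tendsto (fun b => κ (φ b)) (𝓝 a) (𝓝 0) := by
      have := κ.continuous.continuousAt.tendsto.comp hφc.continuousAt.tendsto
      rwa [hφa, map_zero] at this
    filter_upwards [h1.eventually hγF, hβφ] with b h2 h3 hb
    rw [hF, h3 hb] at h2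
    rw [h2, h3 hb]

theorem IsDefCrSubmanifold.min_dim {X : Set (Fin n → ℝ)} (hX : IsDefCrSubmanifold L r n d X) :
    IsDefCrSubmanifold L r n (min d n) X := by
  have h : ∀ i : Fin n, min d n ≤ (i : ℕ) ↔ d ≤ (i : ℕ) := fun i => by omega
  simpa only [IsDefCrSubmanifold, h] using hX

theorem DefFn.defMapOn {m n : ℕ} {W : Set (Fin m → ℝ)} {ρ : (Fin m → ℝ) → (Fin n → ℝ)}
    (hρ : DefFn L ρ) (hW : Def L m W) : DefMapOn L m n W ρ := by
  have h1 : DefFn L (fstFun : (Fin (m + n) → ℝ) → (Fin m → ℝ)) :=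
    DefFn.pi fun i => defFn_apply _
  have h2 : DefFn L (sndFun : (Fin (m + n) → ℝ) → (Fin n → ℝ)) :=
    DefFn.pi fun i => defFn_apply _
  exact DefP.def ((DefP.mem hW h1).and (DefP.eq h2 (hρ.comp h1)))

variable [hF : Fact (ExpandsOrderedField L)] [hO : Fact (LocallyOMinimal L)]

theorem IsDefCrSubmanifold.hasRetraction {X : Set (Fin n → ℝ)} (hX : IsDefCrSubmanifold L r n d X)
    (hr : r ≠ 0) : HasRetraction L r X :=
  hasRetraction_of_forall_exists_regAt hX.1 fun _ ha =>
    hX.min_dim.exists_regAt hr (min_le_right _ _) ha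

end Charts

/-- a definable `C^r` submanifold of `ℝⁿ` admits a definable `C^r` retraction
from a definable open neighborhood. -/
theorem statement3
    (hfield : ExpandsOrderedField L) (hlom : LocallyOMinimal L)
    (r : ℕ) (hr : 1 ≤ r) (n d : ℕ)
    (X : Set (Fin n → ℝ)) (hX : IsDefCrSubmanifold L r n d X) :
    ∃ U : Set (Fin n → ℝ), Def L n U ∧ IsOpen U ∧ X ⊆ U ∧
      ∃ ρ : (Fin n → ℝ) → (Fin n → ℝ),
        DefCrMapOn L r n n U ρ ∧ Set.MapsTo ρ U X ∧ ∀ x ∈ X, ρ x = x := by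
  have : Fact (ExpandsOrderedField L) := ⟨hfield⟩
  have : Fact (LocallyOMinimal L) := ⟨hlom⟩
  obtain ⟨W, ρ, h1, h2, h3, h4, h5, h6⟩ := hX.hasRetraction (Nat.one_le_iff_ne_zero.1 hr)
  exact ⟨W, h1, h2, h3, ρ, ⟨h4.defMapOn h1, fun a ha =>
    ⟨W, ρ, ha, h2, fun u hu => (h5 u hu).1.contDiffWithinAt, fun _ _ => rfl⟩⟩,
    fun u hu => (h5 u hu).2, h6⟩

end Paper
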